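/- arXiv:2003.07128 — 3 statements merged into one kernel-verified Lean document; each statement's English description precedes it below -/
import Mathlib

section
/- Let α ∈ (0,1), let k be a nonzero integer, and let a ∈ ℝ with −(1−α)/2 < a ≤ 2α. Then there exists a constant C > 0 such that for every measurable square-integrable g : (0,∞) → ℝ with g ≥ 0, one has ∫₀^∞ ( x^a · k² · ∫₀^∞ G_{α,k}(x,ρ)·g(ρ) dρ )² dx ≤ C² · ∫₀^∞ g(x)² dx. In particular, the integral operator with kernel x^a k² G_{α,k}(x,ρ) extends to an everywhere defined bounded operator on L²((0,∞)). -/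
open MeasureTheory

/-- The function `Φ_{α,k}(x) = √(π(1+α)/(2|k|)) · x^{−α/2} · exp(−|k|x^{1+α}/(1+α))`. -/
noncomputable def PhiG (α : ℝ) (k : ℤ) (x : ℝ) : ℝ :=
  Real.sqrt (Real.pi * (1 + α) / (2 * |(k : ℝ)|)) * x ^ (-(α / 2)) *
    Real.exp (-(|(k : ℝ)| * x ^ (1 + α) / (1 + α)))

/-- The function `F_{α,k}(x) = √(2(1+α)/(π|k|)) · x^{−α/2} · sinh(|k|x^{1+α}/(1+α))`. -/
noncomputable def FG (α : ℝ) (k : ℤ) (x : ℝ) : ℝ :=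
  Real.sqrt (2 * (1 + α) / (Real.pi * |(k : ℝ)|)) * x ^ (-(α / 2)) *
    Real.sinh (|(k : ℝ)| * x ^ (1 + α) / (1 + α))

/-- The Green kernel `G_{α,k}(r,ρ)`, equal to `(1+α)⁻¹ Φ_{α,k}(r) F_{α,k}(ρ)` for `ρ < r`
and to `(1+α)⁻¹ F_{α,k}(r) Φ_{α,k}(ρ)` for `r ≤ ρ`. -/
noncomputable def GreenG (α : ℝ) (k : ℤ) (r ρ : ℝ) : ℝ :=
  if ρ < r then (1 + α)⁻¹ * PhiG α k r * FG α k ρ else (1 + α)⁻¹ * FG α k r * PhiG α k ρ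

lemma gx_schur (μ : Measure ℝ) [SFinite μ] (K : ℝ → ℝ → ENNReal)
    (hK : Measurable (Function.uncurry K)) (h w v f : ℝ → ENNReal)
    (hh : Measurable h) (hw : Measurable w) (hv : Measurable v) (hf : Measurable f)
    (h0 : ∀ᵐ x ∂μ, h x ≠ 0 ∧ h x ≠ ⊤) (B : ENNReal)
    (H1 : ∀ᵐ x ∂μ, ∫⁻ y, K x y * h y ∂μ ≤ w x)
    (H2 : ∀ᵐ y ∂μ, ∫⁻ x, v x * w x * K x y ∂μ ≤ B * h y) :
    ∫⁻ x, v x * (∫⁻ y, K x y * f y ∂μ) ^ 2 ∂μ ≤ B * ∫⁻ y, f y ^ 2 ∂μ := by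
  have hK1 : ∀ x, Measurable (K x) := fun x => hK.comp measurable_prodMk_left
  have hK2 : ∀ y, Measurable (fun x => K x y) := fun y => hK.comp measurable_prodMk_right
  have hm : ∀ x, Measurable (fun y => K x y * (f y ^ 2 * (h y)⁻¹)) := fun x =>
    (hK1 x).mul ((hf.pow_const 2).mul hh.inv)
  have hm2 : ∀ y, Measurable (fun x => v x * w x * K x y) := fun y => (hv.mul hw).mul (hK2 y)
  have cs : ∀ x, (∫⁻ y, K x y * f y ∂μ) ^ 2 ≤
      (∫⁻ y, K x y * h y ∂μ) * ∫⁻ y, K x y * (f y ^ 2 * (h y)⁻¹) ∂μ := by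
    intro x
    have hc : Real.HolderConjugate 2 2 := by
      rw [Real.holderConjugate_iff]; norm_num
    have key := ENNReal.lintegral_mul_le_Lp_mul_Lq μ hc
      (f := fun y => (K x y * h y) ^ (1/2:ℝ)) (g := fun y => (K x y * (f y ^ 2 * (h y)⁻¹)) ^ (1/2:ℝ))
      (((hK1 x).mul hh).pow_const _).aemeasurable
      ((hm x).pow_const _).aemeasurable
    have e : ∫⁻ y, K x y * f y ∂μ = ∫⁻ y, ((fun y => (K x y * h y) ^ (1/2:ℝ)) *
        (fun y => (K x y * (f y ^ 2 * (h y)⁻¹)) ^ (1/2:ℝ))) y ∂μ := by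
      apply lintegral_congr_ae
      filter_upwards [h0] with y hy
      simp only [Pi.mul_apply]
      rw [← ENNReal.mul_rpow_of_nonneg _ _ (by norm_num)]
      have : K x y * h y * (K x y * (f y ^ 2 * (h y)⁻¹)) = (K x y * f y) ^ (2:ℝ) := by
        rw [ENNReal.rpow_two]
        calc _ = (K x y * f y)^2 * (h y * (h y)⁻¹) := by ring
          _ = _ := by rw [ENNReal.mul_inv_cancel hy.1 hy.2, mul_one]
      rw [this, ← ENNReal.rpow_mul]; norm_num
    rw [← e] at key
    have s : ∀ z : ENNReal, (z ^ (1/2:ℝ)) ^ (2:ℝ) = z := by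
      intro z; rw [← ENNReal.rpow_mul]; norm_num
    simp only [s] at key
    calc _ ≤ ((∫⁻ y, K x y * h y ∂μ)^(1/2:ℝ) *
        (∫⁻ y, K x y * (f y ^ 2 * (h y)⁻¹) ∂μ)^(1/2:ℝ)) ^ 2 := by gcongr
      _ = _ := by
        rw [← ENNReal.rpow_two, ENNReal.mul_rpow_of_nonneg _ _ (by norm_num), s, s]
  calc ∫⁻ x, v x * (∫⁻ y, K x y * f y ∂μ) ^ 2 ∂μ
      ≤ ∫⁻ x, ∫⁻ y, v x * w x * (K x y * (f y ^ 2 * (h y)⁻¹)) ∂μ ∂μ := by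
        apply lintegral_mono_ae
        filter_upwards [H1] with x hx
        rw [lintegral_const_mul _ (hm x), mul_assoc]
        gcongr
        exact (cs x).trans (by gcongr)
    _ = ∫⁻ y, ∫⁻ x, v x * w x * (K x y * (f y ^ 2 * (h y)⁻¹)) ∂μ ∂μ := by
        apply lintegral_lintegral_swap
        apply Measurable.aemeasurable
        exact ((hv.comp measurable_fst).mul (hw.comp measurable_fst)).mul
          (hK.mul (((hf.comp measurable_snd).pow_const 2).mul (hh.comp measurable_snd).inv))
    _ ≤ ∫⁻ y, B * f y ^ 2 ∂μ := by
        apply lintegral_mono_ae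
        filter_upwards [H2, h0] with y hy hy0
        calc ∫⁻ x, v x * w x * (K x y * (f y ^ 2 * (h y)⁻¹)) ∂μ
            = (∫⁻ x, v x * w x * K x y ∂μ) * (f y ^ 2 * (h y)⁻¹) := by
              rw [← lintegral_mul_const _ (hm2 y)]
              simp only [mul_assoc]
          _ ≤ (B * h y) * (f y ^ 2 * (h y)⁻¹) := by gcongr
          _ = B * f y ^ 2 * (h y * (h y)⁻¹) := by ring
          _ = _ := by rw [ENNReal.mul_inv_cancel hy0.1 hy0.2, mul_one]
    _ = _ := lintegral_const_mul _ (hf.pow_const 2)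

/-- phase function -/
noncomputable def gxS (α N x : ℝ) : ℝ := N * x ^ (1 + α) / (1 + α)

noncomputable def gxE (α N r ρ : ℝ) : ℝ :=
  if ρ < r then Real.exp (-gxS α N r) * Real.sinh (gxS α N ρ)
  else Real.sinh (gxS α N r) * Real.exp (-gxS α N ρ)

lemma gxS_nonneg {α N x : ℝ} (hα : 0 < α) (hN : 0 < N) (hx : 0 ≤ x) : 0 ≤ gxS α N x := by
  unfold gxS; positivity

lemma gxS_deriv {α N : ℝ} (hα : 0 < α) (x : ℝ) :
    HasDerivAt (gxS α N) (N * x ^ α) x := by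
  unfold gxS
  have := ((Real.hasDerivAt_rpow_const (x := x) (p := 1 + α) (Or.inr (by linarith))).const_mul N).div_const (1+α)
  refine this.congr_deriv ?_
  have h : 1 + α ≠ 0 := by linarith
  rw [show 1 + α - 1 = α by ring]
  field_simp

lemma gxS_cont {α N : ℝ} (hα : 0 < α) : Continuous (gxS α N) :=
  continuous_iff_continuousAt.2 fun x => (gxS_deriv hα x).continuousAt

lemma gxS_tendsto {α N : ℝ} (hα : 0 < α) (hN : 0 < N) :
    Filter.Tendsto (gxS α N) Filter.atTop Filter.atTop := by
  unfold gxS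
  exact ((tendsto_rpow_atTop (by linarith)).const_mul_atTop hN).atTop_div_const (by linarith)

lemma gxE_symm (α N r ρ : ℝ) : gxE α N r ρ = gxE α N ρ r := by
  unfold gxE
  rcases lt_trichotomy r ρ with h | h | h
  · rw [if_neg (not_lt.2 h.le), if_pos h]; ring
  · subst h; rfl
  · rw [if_pos h, if_neg (not_lt.2 h.le)]; ring

lemma gxE_nonneg {α N r ρ : ℝ} (hα : 0 < α) (hN : 0 < N) (hr : 0 ≤ r) (hρ : 0 ≤ ρ) :
    0 ≤ gxE α N r ρ := by
  have h1 := Real.sinh_nonneg_iff.2 (gxS_nonneg hα hN hr)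
  have h2 := Real.sinh_nonneg_iff.2 (gxS_nonneg hα hN hρ)
  unfold gxE; split_ifs <;> positivity

lemma gxE_meas {α N : ℝ} (hα : 0 < α) : Measurable (Function.uncurry (gxE α N)) := by
  have hS := (gxS_cont (N := N) hα).measurable
  unfold gxE Function.uncurry
  refine Measurable.ite (measurableSet_lt measurable_snd measurable_fst) ?_ ?_
  · exact (Real.measurable_exp.comp (hS.comp measurable_fst).neg).mul
      (Real.measurable_sinh.comp (hS.comp measurable_snd))
  · exact (Real.measurable_sinh.comp (hS.comp measurable_fst)).mul
      (Real.measurable_exp.comp (hS.comp measurable_snd).neg)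

lemma gx_I1 {α N x : ℝ} (hα : 0 < α) (hN : 0 < N) (hx : 0 < x) :
    ∫⁻ ρ in Set.Ioo 0 x, ENNReal.ofReal (ρ ^ α * Real.sinh (gxS α N ρ)) =
      ENNReal.ofReal ((Real.cosh (gxS α N x) - 1) / N) := by
  have hc : Continuous (fun ρ : ℝ => ρ ^ α * Real.sinh (gxS α N ρ)) :=
    (Real.continuous_rpow_const hα.le).mul (Real.continuous_sinh.comp (gxS_cont hα))
  have hi := hc.intervalIntegrable (μ := volume) 0 x
  have h := intervalIntegral.integral_eq_sub_of_hasDerivAt (a := 0) (b := x)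
    (f := fun ρ => Real.cosh (gxS α N ρ) / N) (f' := fun ρ : ℝ => ρ ^ α * Real.sinh (gxS α N ρ))
    (fun ρ _ => by
      refine ((gxS_deriv (N := N) hα ρ).cosh.div_const N).congr_deriv ?_
      field_simp) hi
  have h0 : gxS α N 0 = 0 := by
    unfold gxS; rw [Real.zero_rpow (by linarith)]; simp
  rw [intervalIntegral.integral_of_le hx.le, h0, Real.cosh_zero, ← sub_div] at h
  rw [← h, integral_Ioc_eq_integral_Ioo, ofReal_integral_eq_lintegral_ofReal]
  · exact ((intervalIntegrable_iff_integrableOn_Ioo_of_le hx.le).1 hi)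
  · filter_upwards [ae_restrict_mem measurableSet_Ioo] with ρ hρ
    have := Real.sinh_nonneg_iff.2 (gxS_nonneg hα hN hρ.1.le)
    have := hρ.1.le
    simp only [Pi.zero_apply]; positivity

lemma gx_I2 {α N x : ℝ} (hα : 0 < α) (hN : 0 < N) (hx : 0 < x) :
    ∫⁻ ρ in Set.Ici x, ENNReal.ofReal (ρ ^ α * Real.exp (-gxS α N ρ)) =
      ENNReal.ofReal (Real.exp (-gxS α N x) / N) := by
  have hd : ∀ ρ ∈ Set.Ici x, HasDerivAt (fun ρ => -(Real.exp (-gxS α N ρ) / N))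
      (ρ ^ α * Real.exp (-gxS α N ρ)) ρ := fun ρ _ => by
    refine ((gxS_deriv (N := N) hα ρ).neg.exp.div_const N).neg.congr_deriv ?_
    simp only [Pi.neg_apply]
    field_simp
  have hp : ∀ ρ ∈ Set.Ioi x, 0 ≤ ρ ^ α * Real.exp (-gxS α N ρ) := fun ρ hρ => by
    have : 0 < ρ := hx.trans hρ
    positivity
  have ht : Filter.Tendsto (fun ρ => -(Real.exp (-gxS α N ρ) / N)) Filter.atTop (nhds 0) := by
    have := ((Real.tendsto_exp_neg_atTop_nhds_zero.comp (gxS_tendsto hα hN)).div_const N).neg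
    simpa using this
  have h := integral_Ioi_of_hasDerivAt_of_nonneg' hd hp ht
  have hi := integrableOn_Ioi_deriv_of_nonneg' hd hp ht
  rw [zero_sub, neg_neg] at h
  rw [← h, ofReal_integral_eq_lintegral_ofReal hi, setLIntegral_congr Ioi_ae_eq_Ici.symm]
  filter_upwards [ae_restrict_mem measurableSet_Ioi] with ρ hρ using hp ρ hρ

lemma gx_I3 {α N x : ℝ} (hα : 0 < α) (hN : 0 < N) (hx : 0 < x) :
    ∫⁻ ρ in Set.Ici x, ENNReal.ofReal (ρ ^ α * gxS α N ρ * Real.exp (-gxS α N ρ)) =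
      ENNReal.ofReal ((gxS α N x + 1) * Real.exp (-gxS α N x) / N) := by
  have hd : ∀ ρ ∈ Set.Ici x, HasDerivAt (fun ρ => -((gxS α N ρ + 1) * Real.exp (-gxS α N ρ) / N))
      (ρ ^ α * gxS α N ρ * Real.exp (-gxS α N ρ)) ρ := fun ρ _ => by
    have hs := gxS_deriv (N := N) hα ρ
    refine (((hs.add_const 1).mul hs.neg.exp).div_const N).neg.congr_deriv ?_
    simp only [Pi.neg_apply]
    field_simp
    ring
  have hp : ∀ ρ ∈ Set.Ioi x, 0 ≤ ρ ^ α * gxS α N ρ * Real.exp (-gxS α N ρ) := fun ρ hρ => by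
    have h1 : 0 < ρ := hx.trans hρ
    have := gxS_nonneg hα hN h1.le
    positivity
  have ht : Filter.Tendsto (fun ρ => -((gxS α N ρ + 1) * Real.exp (-gxS α N ρ) / N))
      Filter.atTop (nhds 0) := by
    have e1 := Real.tendsto_exp_neg_atTop_nhds_zero.comp (gxS_tendsto hα hN)
    have e2 := (Real.tendsto_pow_mul_exp_neg_atTop_nhds_zero 1).comp (gxS_tendsto hα hN)
    have := ((e2.add e1).div_const N).neg
    simp only [add_zero, zero_div, neg_zero] at this
    refine this.congr fun ρ => ?_
    simp only [Function.comp]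
    ring
  have h := integral_Ioi_of_hasDerivAt_of_nonneg' hd hp ht
  have hi := integrableOn_Ioi_deriv_of_nonneg' hd hp ht
  rw [zero_sub, neg_neg] at h
  rw [← h, ofReal_integral_eq_lintegral_ofReal hi, setLIntegral_congr Ioi_ae_eq_Ici.symm]
  filter_upwards [ae_restrict_mem measurableSet_Ioi] with ρ hρ using hp ρ hρ

lemma gx_split {x : ℝ} (hx : 0 < x) (f : ℝ → ENNReal) :
    ∫⁻ ρ in Set.Ioi 0, f ρ = (∫⁻ ρ in Set.Ioo 0 x, f ρ) + ∫⁻ ρ in Set.Ici x, f ρ := by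
  rw [← Set.Ioo_union_Ici_eq_Ioi hx]
  refine lintegral_union measurableSet_Ici ?_
  rw [Set.disjoint_left]
  rintro y hy hy'
  exact absurd hy.2 (not_lt.2 hy')

lemma gx_sinh_exp (s : ℝ) : Real.sinh s * Real.exp (-s) = (1 - Real.exp (-s) * Real.exp (-s)) / 2 := by
  rw [Real.sinh_eq]
  have : Real.exp s * Real.exp (-s) = 1 := by rw [← Real.exp_add]; simp
  linear_combination this / 2

lemma gx_cosh_exp (s : ℝ) : Real.exp (-s) * Real.cosh s = (1 + Real.exp (-s) * Real.exp (-s)) / 2 := by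
  rw [Real.cosh_eq]
  have : Real.exp s * Real.exp (-s) = 1 := by rw [← Real.exp_add]; simp
  linear_combination this / 2

lemma gx_J1 {α N x : ℝ} (hα : 0 < α) (hN : 0 < N) (hx : 0 < x) :
    ∫⁻ ρ in Set.Ioi 0, ENNReal.ofReal (ρ ^ α * gxE α N x ρ) =
      ENNReal.ofReal ((1 - Real.exp (-gxS α N x)) / N) := by
  have hs := gxS_nonneg hα hN hx.le
  have hsh := Real.sinh_nonneg_iff.2 hs
  rw [gx_split hx]
  have e1 : ∫⁻ ρ in Set.Ioo 0 x, ENNReal.ofReal (ρ ^ α * gxE α N x ρ) =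
      ENNReal.ofReal (Real.exp (-gxS α N x)) * ENNReal.ofReal ((Real.cosh (gxS α N x) - 1) / N) := by
    rw [← gx_I1 hα hN hx, ← lintegral_const_mul' _ _ ENNReal.ofReal_ne_top]
    apply setLIntegral_congr_fun measurableSet_Ioo
    intro ρ hρ
    simp only [gxE, if_pos hρ.2]
    rw [← ENNReal.ofReal_mul (Real.exp_pos _).le]
    ring_nf
  have e2 : ∫⁻ ρ in Set.Ici x, ENNReal.ofReal (ρ ^ α * gxE α N x ρ) =
      ENNReal.ofReal (Real.sinh (gxS α N x)) * ENNReal.ofReal (Real.exp (-gxS α N x) / N) := by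
    rw [← gx_I2 hα hN hx, ← lintegral_const_mul' _ _ ENNReal.ofReal_ne_top]
    apply setLIntegral_congr_fun measurableSet_Ici
    intro ρ hρ
    simp only [gxE, if_neg (not_lt.2 (Set.mem_Ici.1 hρ))]
    rw [← ENNReal.ofReal_mul hsh]
    ring_nf
  have hc := sub_nonneg.2 (Real.one_le_cosh (gxS α N x))
  rw [e1, e2, ← ENNReal.ofReal_mul (by positivity), ← ENNReal.ofReal_mul hsh,
    ← ENNReal.ofReal_add (by positivity) (by positivity)]
  congr 1
  have a1 := gx_sinh_exp (gxS α N x)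
  have a2 := gx_cosh_exp (gxS α N x)
  field_simp
  linear_combination a1 + a2

lemma gx_J2 {α N x : ℝ} (hα : 0 < α) (hα1 : α < 1) (hN : 0 < N) (hx : 0 < x) :
    ∫⁻ ρ in Set.Ioi 0, ENNReal.ofReal (ρ ^ (3 * α) * gxE α N x ρ) ≤
      ENNReal.ofReal (3 / N * x ^ (2 * α)) := by
  have hs := gxS_nonneg hα hN hx.le
  have hsh := Real.sinh_nonneg_iff.2 hs
  rw [gx_split hx]
  have e1 : ∫⁻ ρ in Set.Ioo 0 x, ENNReal.ofReal (ρ ^ (3 * α) * gxE α N x ρ) ≤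
      ENNReal.ofReal (x ^ (2 * α) * Real.exp (-gxS α N x)) *
        ENNReal.ofReal ((Real.cosh (gxS α N x) - 1) / N) := by
    rw [← gx_I1 hα hN hx, ← lintegral_const_mul' _ _ ENNReal.ofReal_ne_top]
    apply setLIntegral_mono' measurableSet_Ioo
    intro ρ hρ
    simp only [gxE, if_pos hρ.2]
    have := Real.sinh_nonneg_iff.2 (gxS_nonneg hα hN hρ.1.le)
    rw [← ENNReal.ofReal_mul (by positivity)]
    apply ENNReal.ofReal_le_ofReal
    have h1 : ρ ^ (3 * α) = ρ ^ (2 * α) * ρ ^ α := by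
      rw [← Real.rpow_add hρ.1]; ring_nf
    have h2 : ρ ^ (2 * α) ≤ x ^ (2 * α) := Real.rpow_le_rpow hρ.1.le hρ.2.le (by linarith)
    have h3 := Real.rpow_nonneg hρ.1.le α
    rw [h1]
    calc _ = ρ ^ (2 * α) * (Real.exp (-gxS α N x) * (ρ ^ α * Real.sinh (gxS α N ρ))) := by ring
      _ ≤ x ^ (2 * α) * (Real.exp (-gxS α N x) * (ρ ^ α * Real.sinh (gxS α N ρ))) := by gcongr
      _ = _ := by ring
  have e2 : ∫⁻ ρ in Set.Ici x, ENNReal.ofReal (ρ ^ (3 * α) * gxE α N x ρ) ≤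
      ENNReal.ofReal (x ^ (α - 1) * ((1 + α) / N) * Real.sinh (gxS α N x)) *
        ENNReal.ofReal ((gxS α N x + 1) * Real.exp (-gxS α N x) / N) := by
    rw [← gx_I3 hα hN hx, ← lintegral_const_mul' _ _ ENNReal.ofReal_ne_top]
    apply setLIntegral_mono' measurableSet_Ici
    intro ρ hρ
    simp only [gxE, if_neg (not_lt.2 (Set.mem_Ici.1 hρ))]
    rw [← ENNReal.ofReal_mul (by positivity)]
    apply ENNReal.ofReal_le_ofReal
    have hρ0 : 0 < ρ := hx.trans_le hρ
    have h1 : ρ ^ (3 * α) = ρ ^ (α - 1) * (ρ ^ α * ρ ^ (1 + α)) := by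
      rw [← Real.rpow_add hρ0, ← Real.rpow_add hρ0]; ring_nf
    have h2 : ρ ^ (α - 1) ≤ x ^ (α - 1) :=
      Real.rpow_le_rpow_of_nonpos hx hρ (by linarith)
    have h4 : ρ ^ (1 + α) = (1 + α) / N * gxS α N ρ := by
      unfold gxS; have : 1 + α ≠ 0 := by linarith
      field_simp
    have h5 := gxS_nonneg hα hN hρ0.le
    rw [h1, h4]
    calc _ = ρ ^ (α - 1) * ((1 + α) / N * Real.sinh (gxS α N x) *
          (ρ ^ α * gxS α N ρ * Real.exp (-gxS α N ρ))) := by ring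
      _ ≤ x ^ (α - 1) * ((1 + α) / N * Real.sinh (gxS α N x) *
          (ρ ^ α * gxS α N ρ * Real.exp (-gxS α N ρ))) := by gcongr
      _ = _ := by ring
  have hc := sub_nonneg.2 (Real.one_le_cosh (gxS α N x))
  refine (add_le_add e1 e2).trans ?_
  rw [← ENNReal.ofReal_mul (by positivity), ← ENNReal.ofReal_mul (by positivity),
    ← ENNReal.ofReal_add (by positivity) (by positivity)]
  apply ENNReal.ofReal_le_ofReal
  have a1 := gx_sinh_exp (gxS α N x)
  have a2 := gx_cosh_exp (gxS α N x)
  have hxx : x ^ (2 * α) = x ^ (α - 1) * ((1 + α) / N) * gxS α N x := by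
    have : x ^ (2 * α) = x ^ (α - 1) * x ^ (1 + α) := by
      rw [← Real.rpow_add hx]; ring_nf
    rw [this]; unfold gxS
    have : 1 + α ≠ 0 := by linarith
    field_simp
  set s := gxS α N x
  have ep := Real.exp_pos (-s)
  have e1' : Real.exp (-s) ≤ 1 := Real.exp_le_one_iff.2 (by linarith)
  have e2' : 1 - s ≤ Real.exp (-s) := by linarith [Real.add_one_le_exp (-s)]
  have b1 : Real.exp (-s) * (Real.cosh s - 1) ≤ 1 := by nlinarith
  have b2 : Real.sinh s * Real.exp (-s) ≤ 1 := by nlinarith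
  have b3 : Real.sinh s * Real.exp (-s) ≤ s := by nlinarith
  have b4 : Real.sinh s * Real.exp (-s) * (s + 1) ≤ 2 * s := by nlinarith
  have q : 0 ≤ x ^ (α - 1) * ((1 + α) / N) := by positivity
  have q2 : 0 ≤ x ^ (2 * α) := by positivity
  calc _ = (x ^ (2 * α) * (Real.exp (-s) * (Real.cosh s - 1)) +
        x ^ (α - 1) * ((1 + α) / N) * (Real.sinh s * Real.exp (-s) * (s + 1))) / N := by ring
    _ ≤ (x ^ (2 * α) * 1 + x ^ (α - 1) * ((1 + α) / N) * (2 * s)) / N := by gcongr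
    _ = (x ^ (2 * α) + 2 * (x ^ (α - 1) * ((1 + α) / N) * s)) / N := by ring
    _ = _ := by rw [← hxx]; ring

lemma gx_one_sub {α N x : ℝ} (hα : 0 < α) (hα1 : α < 1) (hN : 0 < N) (hx : 0 < x) :
    1 - Real.exp (-gxS α N x) ≤ (1 + N) * x ^ (2 * α) := by
  have e2' : 1 - gxS α N x ≤ Real.exp (-gxS α N x) := by
    linarith [Real.add_one_le_exp (-gxS α N x)]
  have ep := Real.exp_pos (-gxS α N x)
  rcases le_total x 1 with h | h
  · have h1 : x ^ (1 + α) ≤ x ^ (2 * α) := Real.rpow_le_rpow_of_exponent_ge hx h (by linarith)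
    have h2 : gxS α N x ≤ N * x ^ (1 + α) := by
      unfold gxS; apply div_le_self (by positivity); linarith
    have h3 : 0 ≤ x ^ (2 * α) := by positivity
    nlinarith
  · have h1 : 1 ≤ x ^ (2 * α) := Real.one_le_rpow h (by linarith)
    nlinarith

lemma gx_green {α : ℝ} (hα : 0 < α) (k : ℤ) (hk : k ≠ 0) (r ρ : ℝ) :
    GreenG α k r ρ = |(k:ℝ)|⁻¹ * r ^ (-(α / 2)) * ρ ^ (-(α / 2)) * gxE α |(k:ℝ)| r ρ := by
  have hN : 0 < |(k:ℝ)| := abs_pos.2 (by exact_mod_cast hk)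
  have h1 : 0 < 1 + α := by linarith
  have hs : Real.sqrt (Real.pi * (1 + α) / (2 * |(k : ℝ)|)) *
      Real.sqrt (2 * (1 + α) / (Real.pi * |(k : ℝ)|)) = (1 + α) / |(k:ℝ)| := by
    rw [← Real.sqrt_mul (by positivity)]
    rw [← Real.sqrt_sq (show 0 ≤ (1 + α) / |(k:ℝ)| by positivity)]
    congr 1
    field_simp
  have hs' : (1 + α)⁻¹ * (Real.sqrt (Real.pi * (1 + α) / (2 * |(k : ℝ)|)) *
      Real.sqrt (2 * (1 + α) / (Real.pi * |(k : ℝ)|))) = |(k:ℝ)|⁻¹ := by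
    rw [hs]; field_simp
  unfold GreenG gxE PhiG FG gxS
  rw [← hs']
  split_ifs <;> ring

lemma gx_green_nonneg {α : ℝ} (hα : 0 < α) (k : ℤ) (hk : k ≠ 0) {r ρ : ℝ} (hr : 0 < r)
    (hρ : 0 < ρ) : 0 ≤ GreenG α k r ρ := by
  have hN : 0 < |(k:ℝ)| := abs_pos.2 (by exact_mod_cast hk)
  have := gxE_nonneg hα hN hr.le hρ.le
  rw [gx_green hα k hk]; positivity

lemma gx_green_meas {α : ℝ} (hα : 0 < α) (k : ℤ) (hk : k ≠ 0) :
    Measurable (Function.uncurry (GreenG α k)) := by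
  have : Function.uncurry (GreenG α k) = fun p : ℝ × ℝ =>
      |(k:ℝ)|⁻¹ * p.1 ^ (-(α / 2)) * p.2 ^ (-(α / 2)) * Function.uncurry (gxE α |(k:ℝ)|) p := by
    funext p; exact gx_green hα k hk p.1 p.2
  rw [this]
  exact (((measurable_fst.pow_const _).const_mul _).mul (measurable_snd.pow_const _)).mul
    (gxE_meas hα)

lemma gx_H1 {α : ℝ} (hα : 0 < α) (k : ℤ) (hk : k ≠ 0) {x : ℝ} (hx : 0 < x) :
    ∫⁻ y in Set.Ioi 0, ENNReal.ofReal (GreenG α k x y) * ENNReal.ofReal (y ^ (3 * α / 2)) =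
      ENNReal.ofReal (|(k:ℝ)|⁻¹ * x ^ (-(α / 2)) *
        ((1 - Real.exp (-gxS α |(k:ℝ)| x)) / |(k:ℝ)|)) := by
  have hN : 0 < |(k:ℝ)| := abs_pos.2 (by exact_mod_cast hk)
  rw [ENNReal.ofReal_mul (by positivity), ← gx_J1 hα hN hx,
    ← lintegral_const_mul' _ _ ENNReal.ofReal_ne_top]
  apply setLIntegral_congr_fun measurableSet_Ioi
  intro y hy
  have hy : 0 < y := hy
  simp only
  rw [← ENNReal.ofReal_mul (gx_green_nonneg hα k hk hx hy), ← ENNReal.ofReal_mul (by positivity),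
    gx_green hα k hk]
  congr 1
  have : y ^ α = y ^ (-(α / 2)) * y ^ (3 * α / 2) := by
    rw [← Real.rpow_add hy]; ring_nf
  rw [this]; ring

lemma gx_H2 {α : ℝ} (hα : 0 < α) (hα1 : α < 1) (k : ℤ) (hk : k ≠ 0) (a : ℝ)
    (ha1 : -(1 - α) / 2 < a) (ha2 : a ≤ 2 * α) {y : ℝ} (hy : 0 < y) :
    ∫⁻ x in Set.Ioi 0, ENNReal.ofReal ((x ^ a * (k:ℝ) ^ 2) ^ 2) *
      ENNReal.ofReal (|(k:ℝ)|⁻¹ * x ^ (-(α / 2)) *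
        ((1 - Real.exp (-gxS α |(k:ℝ)| x)) / |(k:ℝ)|)) * ENNReal.ofReal (GreenG α k x y) ≤
    ENNReal.ofReal (|(k:ℝ)| * (1 + |(k:ℝ)|) + 3) * ENNReal.ofReal (y ^ (3 * α / 2)) := by
  have hN : 0 < |(k:ℝ)| := abs_pos.2 (by exact_mod_cast hk)
  have hk2 : (k:ℝ) ^ 2 = |(k:ℝ)| ^ 2 := (sq_abs _).symm
  simp only [hk2]
  have hgr := fun x => gx_green hα k hk x y
  have hgn := fun x (hx : 0 < x) => gx_green_nonneg hα k hk hx hy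
  simp only [hgr] at hgn ⊢
  set N := |(k:ℝ)|
  have hbd : ∀ x ∈ Set.Ioi (0:ℝ), ENNReal.ofReal ((x ^ a * N ^ 2) ^ 2) *
      ENNReal.ofReal (N⁻¹ * x ^ (-(α / 2)) * ((1 - Real.exp (-gxS α N x)) / N)) *
        ENNReal.ofReal (N⁻¹ * x ^ (-(α / 2)) * y ^ (-(α / 2)) * gxE α N x y) ≤
      ENNReal.ofReal (N * y ^ (-(α / 2)) * N) * ENNReal.ofReal (x ^ α * gxE α N y x) +
      ENNReal.ofReal (N * y ^ (-(α / 2))) * ENNReal.ofReal (x ^ (3 * α) * gxE α N y x) := by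
    intro x hx
    have hx : 0 < x := hx
    have hs := gxS_nonneg hα hN hx.le
    have hE := gxE_nonneg hα hN hx.le hy.le
    have hE' := gxE_nonneg hα hN hy.le hx.le
    have e1 : Real.exp (-gxS α N x) ≤ 1 := Real.exp_le_one_iff.2 (by linarith)
    have e2 : 1 - Real.exp (-gxS α N x) ≤ gxS α N x := by
      linarith [Real.add_one_le_exp (-gxS α N x)]
    have e0 := sub_nonneg.2 e1
    rw [← ENNReal.ofReal_mul (by positivity), ← ENNReal.ofReal_mul (by positivity),
      ← ENNReal.ofReal_mul (by positivity), ← ENNReal.ofReal_mul (by positivity),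
      ← ENNReal.ofReal_add (by positivity) (by positivity)]
    apply ENNReal.ofReal_le_ofReal
    rw [gxE_symm α N y x]
    have hS : gxS α N x ≤ N * x ^ (1 + α) := by
      unfold gxS; apply div_le_self (by positivity); linarith
    have hxa : x ^ a * x ^ a ≤ x ^ (α - 1) + x ^ (4 * α) := by
      rw [← Real.rpow_add hx]
      have p1 : 0 ≤ x ^ (α - 1) := by positivity
      have p2 : 0 ≤ x ^ (4 * α) := by positivity
      rcases le_total x 1 with h | h
      · linarith [Real.rpow_le_rpow_of_exponent_ge hx h (show α - 1 ≤ a + a by linarith)]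
      · linarith [Real.rpow_le_rpow_of_exponent_le h (show a + a ≤ 4 * α by linarith)]
    have hpp : x ^ (-(α / 2)) * x ^ (-(α / 2)) = x ^ (-α) := by
      rw [← Real.rpow_add hx]; ring_nf
    have hp1 : x ^ (α - 1) * x ^ (-α) * x ^ (1 + α) = x ^ α := by
      rw [← Real.rpow_add hx, ← Real.rpow_add hx]; ring_nf
    have hp2 : x ^ (4 * α) * x ^ (-α) = x ^ (3 * α) := by
      rw [← Real.rpow_add hx]; ring_nf
    have key : x ^ a * x ^ a * x ^ (-α) * (1 - Real.exp (-gxS α N x)) ≤ N * x ^ α + x ^ (3 * α) := by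
      calc _ ≤ (x ^ (α - 1) + x ^ (4 * α)) * x ^ (-α) * (1 - Real.exp (-gxS α N x)) := by gcongr
        _ = x ^ (α - 1) * x ^ (-α) * (1 - Real.exp (-gxS α N x)) +
            x ^ (4 * α) * x ^ (-α) * (1 - Real.exp (-gxS α N x)) := by ring
        _ ≤ x ^ (α - 1) * x ^ (-α) * (N * x ^ (1 + α)) + x ^ (4 * α) * x ^ (-α) * 1 := by
            gcongr
            · exact e2.trans hS
            · linarith [Real.exp_pos (-gxS α N x)]
        _ = N * (x ^ (α - 1) * x ^ (-α) * x ^ (1 + α)) + x ^ (4 * α) * x ^ (-α) := by ring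
        _ = _ := by rw [hp1, hp2]
    calc _ = N * y ^ (-(α / 2)) * gxE α N x y *
          (x ^ a * x ^ a * (x ^ (-(α / 2)) * x ^ (-(α / 2))) * (1 - Real.exp (-gxS α N x))) := by
          field_simp
      _ ≤ N * y ^ (-(α / 2)) * gxE α N x y * (N * x ^ α + x ^ (3 * α)) := by
          rw [hpp]; gcongr
      _ = _ := by ring
  refine (setLIntegral_mono' measurableSet_Ioi hbd).trans ?_
  have hEm : Measurable (gxE α N y) := (gxE_meas hα).comp measurable_prodMk_left
  have hm1 : Measurable (fun x : ℝ => ENNReal.ofReal (N * y ^ (-(α / 2)) * N) *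
      ENNReal.ofReal (x ^ α * gxE α N y x)) :=
    (((measurable_id.pow_const _).mul hEm).ennreal_ofReal).const_mul _
  rw [lintegral_add_left hm1, lintegral_const_mul' _ _ ENNReal.ofReal_ne_top,
    lintegral_const_mul' _ _ ENNReal.ofReal_ne_top, gx_J1 hα hN hy]
  refine (add_le_add_right (mul_le_mul_right (gx_J2 hα hα1 hN hy) _) _).trans ?_
  have e1 : Real.exp (-gxS α N y) ≤ 1 :=
    Real.exp_le_one_iff.2 (by linarith [gxS_nonneg hα hN hy.le])
  have e0 := sub_nonneg.2 e1
  rw [← ENNReal.ofReal_mul (by positivity), ← ENNReal.ofReal_mul (by positivity),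
      ← ENNReal.ofReal_mul (by positivity), ← ENNReal.ofReal_add (by positivity) (by positivity)]
  apply ENNReal.ofReal_le_ofReal
  have hp : y ^ (3 * α / 2) = y ^ (-(α / 2)) * y ^ (2 * α) := by
    rw [← Real.rpow_add hy]; ring_nf
  rw [hp]
  calc _ = y ^ (-(α / 2)) * (N * (1 - Real.exp (-gxS α N y)) + 3 * y ^ (2 * α)) := by
        field_simp
    _ ≤ y ^ (-(α / 2)) * (N * ((1 + N) * y ^ (2 * α)) + 3 * y ^ (2 * α)) := by
        gcongr; exact gx_one_sub hα hα1 hN hy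
    _ = _ := by ring

lemma gx_E_le {α N x y : ℝ} (hα : 0 < α) (hα1 : α < 1) (hN : 0 < N) (hx : 0 < x) (hy : 0 < y) :
    gxE α N x y ≤ (1 + N) * y ^ (2 * α) := by
  refine le_trans ?_ (gx_one_sub hα hα1 hN hy)
  have hs := gxS_nonneg hα hN hy.le
  have a1 := gx_sinh_exp (gxS α N y)
  have ep := Real.exp_pos (-gxS α N y)
  have e1 : Real.exp (-gxS α N y) ≤ 1 := Real.exp_le_one_iff.2 (by linarith)
  have hb : Real.sinh (gxS α N y) * Real.exp (-gxS α N y) ≤ 1 - Real.exp (-gxS α N y) := by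
    nlinarith
  refine le_trans ?_ hb
  have hmono : ∀ u v : ℝ, 0 < u → u ≤ v → gxS α N u ≤ gxS α N v := by
    intro u v hu huv
    unfold gxS
    gcongr
  unfold gxE
  split_ifs with h
  · rw [mul_comm]
    have := Real.sinh_nonneg_iff.2 hs
    have := hmono y x hy h.le
    gcongr
  · gcongr
    exact Real.sinh_le_sinh.2 (hmono x y hx (not_lt.1 h))

lemma gx_int {α : ℝ} (hα : 0 < α) (hα1 : α < 1) (k : ℤ) (hk : k ≠ 0) (g : ℝ → ℝ)
    (hg : Measurable g) (hg0 : ∀ x, 0 ≤ g x)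
    (hgi : IntegrableOn (fun x : ℝ => g x ^ 2) (Set.Ioi 0)) {x : ℝ} (hx : 0 < x) :
    IntegrableOn (fun ρ : ℝ => GreenG α k x ρ * g ρ) (Set.Ioi 0) := by
  have hN : 0 < |(k:ℝ)| := abs_pos.2 (by exact_mod_cast hk)
  have hGm : Measurable (GreenG α k x) := (gx_green_meas hα k hk).comp measurable_prodMk_left
  have hGh : IntegrableOn (fun y : ℝ => GreenG α k x y * y ^ (3 * α / 2)) (Set.Ioi 0) := by
    refine ⟨(hGm.mul (measurable_id.pow_const _)).aestronglyMeasurable, ?_⟩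
    rw [hasFiniteIntegral_iff_ofReal]
    · have e : ∫⁻ y in Set.Ioi 0, ENNReal.ofReal (GreenG α k x y * y ^ (3 * α / 2)) =
          ∫⁻ y in Set.Ioi 0, ENNReal.ofReal (GreenG α k x y) * ENNReal.ofReal (y ^ (3 * α / 2)) := by
        apply setLIntegral_congr_fun measurableSet_Ioi
        intro y hy
        exact ENNReal.ofReal_mul (gx_green_nonneg hα k hk hx hy)
      rw [e, gx_H1 hα k hk hx]
      exact ENNReal.ofReal_lt_top
    · filter_upwards [ae_restrict_mem measurableSet_Ioi] with y hy
      have h1 := gx_green_nonneg hα k hk hx hy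
      have hy : 0 < y := hy
      simp only [Pi.zero_apply]; positivity
  set M := |(k:ℝ)|⁻¹ * x ^ (-(α / 2)) * (1 + |(k:ℝ)|) with hM
  refine ((hGh.const_mul M).add hgi).mono' (hGm.mul hg).aestronglyMeasurable ?_
  filter_upwards [ae_restrict_mem measurableSet_Ioi] with y hy
  have h1 := gx_green_nonneg hα k hk hx hy
  have hy : 0 < y := hy
  have h2 : GreenG α k x y ≤ M * y ^ (3 * α / 2) := by
    have hp : y ^ (3 * α / 2) = y ^ (-(α / 2)) * y ^ (2 * α) := by
      rw [← Real.rpow_add hy]; ring_nf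
    rw [gx_green hα k hk, hp]
    calc _ ≤ |(k:ℝ)|⁻¹ * x ^ (-(α / 2)) * y ^ (-(α / 2)) * ((1 + |(k:ℝ)|) * y ^ (2 * α)) := by
          gcongr; exact gx_E_le hα hα1 hN hx hy
      _ = _ := by rw [hM]; ring
  have h3 := hg0 y
  rw [Real.norm_of_nonneg (by positivity)]
  simp only [Pi.add_apply]
  have h4 := mul_le_mul_of_nonneg_left h2 h1
  nlinarith [sq_nonneg (GreenG α k x y - g y), mul_nonneg h1 h3]

/-- For `α ∈ (0,1)`, nonzero `k`, and `a ∈ (−(1−α)/2, 2α]`, the integral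
operator with kernel `x^a k² G_{α,k}(x,ρ)` is bounded on `L²((0,∞))`: there is `C > 0` such
that for every nonnegative measurable square-integrable `g` the kernel is integrated against
`g` (the inner integral converges for every `x > 0`) and
`∫₀^∞ ( x^a k² ∫₀^∞ G_{α,k}(x,ρ) g(ρ) dρ )² dx ≤ C² ∫₀^∞ g²`. -/
theorem green_operator_weighted_bounded (α : ℝ) (hα0 : 0 < α) (hα1 : α < 1)
    (k : ℤ) (hk : k ≠ 0) (a : ℝ) (ha1 : -(1 - α) / 2 < a) (ha2 : a ≤ 2 * α) :
    ∃ C : ℝ, 0 < C ∧ ∀ g : ℝ → ℝ, Measurable g → (∀ x, 0 ≤ g x) →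
      IntegrableOn (fun x : ℝ => g x ^ 2) (Set.Ioi 0) →
      (∀ x : ℝ, 0 < x → IntegrableOn (fun ρ : ℝ => GreenG α k x ρ * g ρ) (Set.Ioi 0)) ∧
      ∫⁻ x in Set.Ioi (0 : ℝ),
          ENNReal.ofReal
            ((x ^ a * (k : ℝ) ^ 2 * ∫ ρ in Set.Ioi (0 : ℝ), GreenG α k x ρ * g ρ) ^ 2) ≤
        ENNReal.ofReal (C ^ 2 * ∫ x in Set.Ioi (0 : ℝ), g x ^ 2) := by
  have hN : 0 < |(k:ℝ)| := abs_pos.2 (by exact_mod_cast hk)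
  have hB : 0 < |(k:ℝ)| * (1 + |(k:ℝ)|) + 3 := by positivity
  refine ⟨Real.sqrt (|(k:ℝ)| * (1 + |(k:ℝ)|) + 3), Real.sqrt_pos.2 hB, ?_⟩
  intro g hg hg0 hgi
  have hint := fun (x : ℝ) (hx : 0 < x) => gx_int hα0 hα1 k hk g hg hg0 hgi hx
  refine ⟨hint, ?_⟩
  have hSm := (gxS_cont (N := |(k:ℝ)|) hα0).measurable
  have main := gx_schur (volume.restrict (Set.Ioi (0:ℝ)))
    (fun x y => ENNReal.ofReal (GreenG α k x y))
    (gx_green_meas hα0 k hk).ennreal_ofReal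
    (fun y => ENNReal.ofReal (y ^ (3 * α / 2)))
    (fun x => ENNReal.ofReal (|(k:ℝ)|⁻¹ * x ^ (-(α / 2)) *
        ((1 - Real.exp (-gxS α |(k:ℝ)| x)) / |(k:ℝ)|)))
    (fun x => ENNReal.ofReal ((x ^ a * (k:ℝ) ^ 2) ^ 2))
    (fun y => ENNReal.ofReal (g y))
    (measurable_id.pow_const _).ennreal_ofReal
    (((measurable_id.pow_const _).const_mul _).mul
      (((Real.measurable_exp.comp hSm.neg).const_sub 1).div_const _)).ennreal_ofReal
    (((measurable_id.pow_const _).mul_const _).pow_const 2).ennreal_ofReal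
    hg.ennreal_ofReal
    (by
      filter_upwards [ae_restrict_mem measurableSet_Ioi] with y hy
      have hy : 0 < y := hy
      exact ⟨(ENNReal.ofReal_pos.2 (by positivity)).ne', ENNReal.ofReal_ne_top⟩)
    (ENNReal.ofReal (|(k:ℝ)| * (1 + |(k:ℝ)|) + 3))
    (by
      filter_upwards [ae_restrict_mem measurableSet_Ioi] with x hx
      exact (gx_H1 hα0 k hk hx).le)
    (by
      filter_upwards [ae_restrict_mem measurableSet_Ioi] with y hy
      exact gx_H2 hα0 hα1 k hk a ha1 ha2 hy)
  rw [Real.sq_sqrt hB.le, ENNReal.ofReal_mul hB.le,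
    ofReal_integral_eq_lintegral_ofReal hgi (Filter.Eventually.of_forall fun x => sq_nonneg _)]
  have eg : ∀ x, ENNReal.ofReal (g x ^ 2) = ENNReal.ofReal (g x) ^ 2 := fun x =>
    ENNReal.ofReal_pow (hg0 x) 2
  simp only [eg]
  refine le_trans (le_of_eq ?_) main
  apply setLIntegral_congr_fun measurableSet_Ioi
  intro x hx
  have hnn : 0 ≤ᵐ[volume.restrict (Set.Ioi (0:ℝ))] fun ρ => GreenG α k x ρ * g ρ := by
    filter_upwards [ae_restrict_mem measurableSet_Ioi] with y hy
    exact mul_nonneg (gx_green_nonneg hα0 k hk hx hy) (hg0 y)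
  simp only
  rw [mul_pow _ (∫ ρ in Set.Ioi (0 : ℝ), GreenG α k x ρ * g ρ), ENNReal.ofReal_mul (sq_nonneg _),
    ENNReal.ofReal_pow (integral_nonneg_of_ae hnn),
    ofReal_integral_eq_lintegral_ofReal (hint x hx) hnn]
  congr 2
  apply setLIntegral_congr_fun measurableSet_Ioi
  intro y hy
  exact ENNReal.ofReal_mul (gx_green_nonneg hα0 k hk hx hy)
end

section
/- Let α ∈ (0,1). Then there exists a constant C > 0, depending only on α, such that for every nonzero integer k and every measurable square-integrable g : (0,∞) → ℝ with g ≥ 0, one has ∫₀^∞ ( x^{2α} · k² · ∫₀^∞ G_{α,k}(x,ρ)·g(ρ) dρ )² dx ≤ C² · ∫₀^∞ g(x)² dx. That is, the operator with kernel x^{2α} k² G_{α,k}(x,ρ) is bounded on L²((0,∞)) uniformly in k. -/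
open MeasureTheory

/-- The exponent `A`. -/
noncomputable def AA (α κ x : ℝ) : ℝ := κ * x ^ (1 + α) / (1 + α)

/-- Symmetric part of the kernel. -/
noncomputable def HH (α κ x ρ : ℝ) : ℝ :=
  if ρ < x then Real.exp (-AA α κ x) * Real.sinh (AA α κ ρ)
  else Real.sinh (AA α κ x) * Real.exp (-AA α κ ρ)

/-- The full kernel. -/
noncomputable def KK (α κ x ρ : ℝ) : ℝ :=
  κ * x ^ (3 * α / 2) * ρ ^ (-(α / 2)) * HH α κ x ρ

lemma HH_symm (α κ x ρ : ℝ) : HH α κ x ρ = HH α κ ρ x := by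
  unfold HH
  rcases lt_trichotomy ρ x with h | h | h
  · rw [if_pos h, if_neg (not_lt.mpr h.le), mul_comm]
  · subst h; rfl
  · rw [if_pos h, if_neg (not_lt.mpr h.le), mul_comm]

lemma HH_le (α κ x ρ : ℝ) (h : ρ ≤ x) :
    HH α κ x ρ = Real.exp (-AA α κ x) * Real.sinh (AA α κ ρ) := by
  unfold HH
  rcases h.lt_or_eq with h | h
  · rw [if_pos h]
  · subst h; simp [mul_comm]

lemma HH_ge (α κ x ρ : ℝ) (h : x ≤ ρ) :
    HH α κ x ρ = Real.sinh (AA α κ x) * Real.exp (-AA α κ ρ) := by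
  unfold HH
  rw [if_neg (not_lt.mpr h)]

lemma AA_nonneg {α κ x : ℝ} (hα : 0 < α) (hκ : 0 < κ) (hx : 0 ≤ x) : 0 ≤ AA α κ x := by
  unfold AA; positivity

lemma AA_pos {α κ x : ℝ} (hα : 0 < α) (hκ : 0 < κ) (hx : 0 < x) : 0 < AA α κ x := by
  unfold AA; positivity

lemma HH_nonneg {α κ x ρ : ℝ} (hα : 0 < α) (hκ : 0 < κ) (hx : 0 < x) (hρ : 0 < ρ) :
    0 ≤ HH α κ x ρ := by
  unfold HH
  have h1 := Real.sinh_nonneg_iff.mpr (AA_nonneg hα hκ hx.le)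
  have h2 := Real.sinh_nonneg_iff.mpr (AA_nonneg hα hκ hρ.le)
  split_ifs <;> positivity

lemma KK_nonneg {α κ x ρ : ℝ} (hα : 0 < α) (hκ : 0 < κ) (hx : 0 < x) (hρ : 0 < ρ) :
    0 ≤ KK α κ x ρ := by
  unfold KK
  have := HH_nonneg hα hκ hx hρ
  positivity

lemma AA_deriv {α κ x : ℝ} (hα : 0 < α) (hx : 0 < x) :
    HasDerivAt (AA α κ) (κ * x ^ α) x := by
  unfold AA
  have h := ((Real.hasDerivAt_rpow_const (p := 1 + α) (Or.inl hx.ne')).const_mul κ).div_const (1 + α)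
  have e : κ * ((1 + α) * x ^ (1 + α - 1)) / (1 + α) = κ * x ^ α := by
    rw [show 1 + α - 1 = α by ring]
    have : 1 + α ≠ 0 := by positivity
    field_simp
  rw [e] at h
  exact h

lemma AA_cont {α κ : ℝ} (hα : 0 < α) : Continuous (AA α κ) := by
  unfold AA
  have : Continuous fun x : ℝ => x ^ (1 + α) := Real.continuous_rpow_const (by positivity)
  fun_prop

lemma AA_tendsto {α κ : ℝ} (hα : 0 < α) (hκ : 0 < κ) :
    Filter.Tendsto (AA α κ) Filter.atTop Filter.atTop := by
  unfold AA
  apply Filter.Tendsto.atTop_div_const (by positivity)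
  exact (tendsto_rpow_atTop (by positivity)).const_mul_atTop hκ

lemma Green_eq {α : ℝ} (hα : 0 < α) {k : ℤ} (hk : k ≠ 0) {x ρ : ℝ} (hx : 0 < x) (hρ : 0 < ρ) :
    x ^ (2 * α) * (k : ℝ) ^ 2 * GreenG α k x ρ = KK α |(k : ℝ)| x ρ := by
  have hκ : 0 < |(k : ℝ)| := abs_pos.mpr (by exact_mod_cast hk)
  have h2 : (k : ℝ) ^ 2 = |(k : ℝ)| ^ 2 := (sq_abs _).symm
  rw [h2]
  unfold GreenG PhiG FG KK HH AA
  generalize |(k : ℝ)| = κ at *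
  have hs : Real.sqrt (Real.pi * (1 + α) / (2 * κ)) * Real.sqrt (2 * (1 + α) / (Real.pi * κ))
      = (1 + α) / κ := by
    rw [← Real.sqrt_mul (by positivity)]
    rw [Real.sqrt_eq_iff_mul_self_eq (by positivity) (by positivity)]
    field_simp
  have hx2 : x ^ (3 * α / 2) = x ^ (2 * α) * x ^ (-(α / 2)) := by
    rw [← Real.rpow_add hx]; congr 1; ring
  rw [hx2]
  have hc : (1 + α)⁻¹ * (Real.sqrt (Real.pi * (1 + α) / (2 * κ)) *
      Real.sqrt (2 * (1 + α) / (Real.pi * κ))) * κ ^ 2 = κ := by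
    rw [hs]; field_simp
  generalize Real.sqrt (Real.pi * (1 + α) / (2 * κ)) = s1 at *
  generalize Real.sqrt (2 * (1 + α) / (Real.pi * κ)) = s2 at *
  generalize Real.exp (-(κ * x ^ (1 + α) / (1 + α))) = e1 at *
  generalize Real.exp (-(κ * ρ ^ (1 + α) / (1 + α))) = e2 at *
  generalize Real.sinh (κ * x ^ (1 + α) / (1 + α)) = e3 at *
  generalize Real.sinh (κ * ρ ^ (1 + α) / (1 + α)) = e4 at *
  split_ifs
  · conv_rhs => rw [← hc]
    ring
  · conv_rhs => rw [← hc]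
    ring

lemma lint_Ioi {f f' : ℝ → ℝ} {a m : ℝ} (hd : ∀ x ∈ Set.Ici a, HasDerivAt f (f' x) x)
    (hp : ∀ x ∈ Set.Ioi a, 0 ≤ f' x) (ht : Filter.Tendsto f Filter.atTop (nhds m)) :
    ∫⁻ x in Set.Ioi a, ENNReal.ofReal (f' x) = ENNReal.ofReal (m - f a) := by
  rw [← integral_Ioi_of_hasDerivAt_of_nonneg' hd hp ht]
  rw [ofReal_integral_eq_lintegral_ofReal (integrableOn_Ioi_deriv_of_nonneg' hd hp ht)]
  exact (ae_restrict_iff' measurableSet_Ioi).mpr (Filter.Eventually.of_forall hp)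

lemma lint_Ioc {f f' : ℝ → ℝ} {a b : ℝ} (hab : a ≤ b) (hc : ContinuousOn f (Set.Icc a b))
    (hd : ∀ x ∈ Set.Ioc a b, HasDerivAt f (f' x) x)
    (hp : ∀ x ∈ Set.Ioc a b, 0 ≤ f' x) :
    ∫⁻ x in Set.Ioc a b, ENNReal.ofReal (f' x) = ENNReal.ofReal (f b - f a) := by
  have hi : IntegrableOn f' (Set.Ioc a b) :=
    intervalIntegral.integrableOn_deriv_of_nonneg hc
      (fun x hx => hd x (Set.Ioo_subset_Ioc_self hx)) (fun x hx => hp x (Set.Ioo_subset_Ioc_self hx))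
  rw [← intervalIntegral.integral_eq_sub_of_hasDerivAt_of_le hab hc
      (fun x hx => hd x (Set.Ioo_subset_Ioc_self hx))
      ((intervalIntegrable_iff_integrableOn_Ioc_of_le hab).mpr hi),
    intervalIntegral.integral_of_le hab]
  rw [ofReal_integral_eq_lintegral_ofReal hi]
  exact (ae_restrict_iff' measurableSet_Ioc).mpr (Filter.Eventually.of_forall hp)

lemma int_sinh {α κ x : ℝ} (hα : 0 < α) (hκ : 0 < κ) (hx : 0 < x) :
    ∫⁻ ρ in Set.Ioc 0 x, ENNReal.ofReal (κ * ρ ^ α * Real.sinh (AA α κ ρ))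
      = ENNReal.ofReal (Real.cosh (AA α κ x) - 1) := by
  have h0 : AA α κ 0 = 0 := by
    unfold AA; rw [Real.zero_rpow (by positivity)]; simp
  have := lint_Ioc (f := fun ρ => Real.cosh (AA α κ ρ))
    (f' := fun ρ => κ * ρ ^ α * Real.sinh (AA α κ ρ)) hx.le
    (Real.continuous_cosh.comp (AA_cont hα)).continuousOn
    (fun ρ hρ => by
      have h := (AA_deriv (κ := κ) hα hρ.1).cosh
      rwa [mul_comm] at h)
    (fun ρ hρ => by
      have h2 := Real.sinh_nonneg_iff.mpr (AA_nonneg hα hκ hρ.1.le)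
      have := hρ.1
      positivity)
  simpa [h0] using this

lemma int_exp {α κ x : ℝ} (hα : 0 < α) (hκ : 0 < κ) (hx : 0 < x) :
    ∫⁻ ρ in Set.Ioi x, ENNReal.ofReal (κ * ρ ^ α * Real.exp (-AA α κ ρ))
      = ENNReal.ofReal (Real.exp (-AA α κ x)) := by
  have := lint_Ioi (f := fun ρ => -Real.exp (-AA α κ ρ)) (m := 0) (a := x)
    (f' := fun ρ => κ * ρ ^ α * Real.exp (-AA α κ ρ))
    (fun ρ hρ => by
      have h := (AA_deriv (κ := κ) hα (hx.trans_le hρ)).fun_neg.exp.fun_neg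
      exact h.congr_deriv (by ring))
    (fun ρ hρ => by
      have : 0 < ρ := hx.trans hρ
      positivity)
    (by
      have h := (Real.tendsto_exp_neg_atTop_nhds_zero.comp (AA_tendsto hα hκ)).neg
      simpa using h)
  simpa using this

lemma int_mul_exp {α κ x : ℝ} (hα : 0 < α) (hκ : 0 < κ) (hx : 0 < x) :
    ∫⁻ ρ in Set.Ioi x, ENNReal.ofReal (κ * ρ ^ α * (AA α κ ρ * Real.exp (-AA α κ ρ)))
      = ENNReal.ofReal ((AA α κ x + 1) * Real.exp (-AA α κ x)) := by
  have := lint_Ioi (f := fun ρ => -((AA α κ ρ + 1) * Real.exp (-AA α κ ρ))) (m := 0) (a := x)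
    (f' := fun ρ => κ * ρ ^ α * (AA α κ ρ * Real.exp (-AA α κ ρ)))
    (fun ρ hρ => by
      have h1 := AA_deriv (κ := κ) hα (hx.trans_le hρ)
      have h := ((h1.add_const 1).fun_mul h1.fun_neg.exp).fun_neg
      exact h.congr_deriv (by ring))
    (fun ρ hρ => by
      have : 0 < ρ := hx.trans hρ
      have := AA_nonneg hα hκ this.le
      positivity)
    (by
      have h1 := Real.tendsto_exp_neg_atTop_nhds_zero.comp (AA_tendsto hα hκ)
      have h2 := (Real.tendsto_pow_mul_exp_neg_atTop_nhds_zero 1).comp (AA_tendsto hα hκ)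
      have h := (h2.add h1).neg
      simp only [add_zero, neg_zero] at h
      refine h.congr fun y => ?_
      simp only [Function.comp, pow_one]
      ring)
  simpa using this

lemma sinh_mul_exp (T : ℝ) : Real.sinh T * Real.exp (-T) = (1 - Real.exp (-(2 * T))) / 2 := by
  rw [Real.sinh_eq, div_mul_eq_mul_div, sub_mul, ← Real.exp_add, ← Real.exp_add]
  congr 3
  · simp
  · ring_nf

lemma sinh_mul_exp_le_half (T : ℝ) : Real.sinh T * Real.exp (-T) ≤ 1 / 2 := by
  rw [sinh_mul_exp]
  have := Real.exp_pos (-(2 * T))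
  linarith

lemma sinh_mul_exp_le (T : ℝ) : Real.sinh T * Real.exp (-T) ≤ T := by
  rw [sinh_mul_exp]
  have := Real.add_one_le_exp (-(2 * T))
  linarith

lemma cosh_mul_exp_le {T : ℝ} (hT : 0 ≤ T) : Real.exp (-T) * (Real.cosh T - 1) ≤ 1 / 2 := by
  have h1 : Real.exp (-T) * Real.exp T = 1 := by rw [← Real.exp_add]; simp
  have h2 : Real.exp (-T) ≤ 1 := Real.exp_le_one_iff.mpr (by linarith)
  have h3 := Real.exp_pos (-T)
  rw [Real.cosh_eq]
  nlinarith

lemma split_Ioi {x : ℝ} (hx : 0 < x) (f : ℝ → ENNReal) :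
    ∫⁻ ρ in Set.Ioi 0, f ρ = (∫⁻ ρ in Set.Ioc 0 x, f ρ) + ∫⁻ ρ in Set.Ioi x, f ρ := by
  rw [← lintegral_union measurableSet_Ioi, Set.Ioc_union_Ioi_eq_Ioi hx.le]
  exact Set.Ioc_disjoint_Ioi le_rfl

lemma schur1 {α κ x : ℝ} (hα : 0 < α) (hκ : 0 < κ) (hx : 0 < x) :
    ∫⁻ ρ in Set.Ioi 0, ENNReal.ofReal (KK α κ x ρ * ρ ^ (3 * α / 2))
      ≤ ENNReal.ofReal (x ^ (3 * α / 2)) := by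
  have hs := Real.sinh_nonneg_iff.mpr (AA_nonneg hα hκ hx.le)
  have hc := Real.one_le_cosh (AA α κ x)
  have hw : ∀ ρ : ℝ, 0 < ρ → KK α κ x ρ * ρ ^ (3 * α / 2)
      = x ^ (3 * α / 2) * (κ * ρ ^ α * HH α κ x ρ) := by
    intro ρ hρ
    have : ρ ^ α = ρ ^ (-(α / 2)) * ρ ^ (3 * α / 2) := by
      rw [← Real.rpow_add hρ]; congr 1; ring
    rw [this]; unfold KK; ring
  rw [split_Ioi hx]
  have e1 : ∫⁻ ρ in Set.Ioc 0 x, ENNReal.ofReal (KK α κ x ρ * ρ ^ (3 * α / 2))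
      = ENNReal.ofReal (x ^ (3 * α / 2) * Real.exp (-AA α κ x)) *
        ENNReal.ofReal (Real.cosh (AA α κ x) - 1) := by
    rw [← int_sinh hα hκ hx, ← lintegral_const_mul' _ _ ENNReal.ofReal_ne_top]
    refine setLIntegral_congr_fun measurableSet_Ioc fun ρ hρ => ?_
    rw [← ENNReal.ofReal_mul (by positivity), hw ρ hρ.1, HH_le _ _ _ _ hρ.2]
    congr 1; ring
  have e2 : ∫⁻ ρ in Set.Ioi x, ENNReal.ofReal (KK α κ x ρ * ρ ^ (3 * α / 2))
      = ENNReal.ofReal (x ^ (3 * α / 2) * Real.sinh (AA α κ x)) *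
        ENNReal.ofReal (Real.exp (-AA α κ x)) := by
    rw [← int_exp hα hκ hx, ← lintegral_const_mul' _ _ ENNReal.ofReal_ne_top]
    refine setLIntegral_congr_fun measurableSet_Ioi fun ρ hρ => ?_
    rw [← ENNReal.ofReal_mul (by positivity), hw ρ (hx.trans hρ), HH_ge _ _ _ _ (le_of_lt hρ)]
    congr 1; ring
  rw [e1, e2, ← ENNReal.ofReal_mul (by positivity), ← ENNReal.ofReal_mul (by positivity),
    ← ENNReal.ofReal_add (mul_nonneg (by positivity) (by linarith)) (by positivity)]
  apply ENNReal.ofReal_le_ofReal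
  have h1 := sinh_mul_exp_le_half (AA α κ x)
  have h2 := cosh_mul_exp_le (AA_nonneg hα hκ hx.le)
  have h3 : 0 ≤ x ^ (3 * α / 2) := by positivity
  calc _ = x ^ (3 * α / 2) * (Real.exp (-AA α κ x) * (Real.cosh (AA α κ x) - 1)
        + Real.sinh (AA α κ x) * Real.exp (-AA α κ x)) := by ring
    _ ≤ x ^ (3 * α / 2) * 1 := mul_le_mul_of_nonneg_left (by linarith) h3
    _ = _ := mul_one _

lemma schur2 {α κ ρ : ℝ} (hα : 0 < α) (hα1 : α < 1) (hκ : 0 < κ) (hρ : 0 < ρ) :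
    ∫⁻ x in Set.Ioi 0, ENNReal.ofReal (KK α κ x ρ * x ^ (3 * α / 2))
      ≤ ENNReal.ofReal (4 * ρ ^ (3 * α / 2)) := by
  have hT := AA_pos hα hκ hρ
  have hs := Real.sinh_nonneg_iff.mpr hT.le
  have hc := Real.one_le_cosh (AA α κ ρ)
  have hw : ∀ x : ℝ, 0 < x → KK α κ x ρ * x ^ (3 * α / 2)
      = ρ ^ (-(α / 2)) * (κ * x ^ α * HH α κ ρ x) * x ^ (2 * α) := by
    intro x hx
    have : x ^ (3 * α / 2) * x ^ (3 * α / 2) = x ^ α * x ^ (2 * α) := by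
      rw [← Real.rpow_add hx, ← Real.rpow_add hx]; congr 1; ring
    rw [HH_symm]; unfold KK
    calc _ = κ * ρ ^ (-(α / 2)) * HH α κ x ρ * (x ^ (3 * α / 2) * x ^ (3 * α / 2)) := by ring
      _ = _ := by rw [this]; ring
  have hr : ρ ^ (3 * α / 2) = ρ ^ (-(α / 2)) * ρ ^ (2 * α) := by
    rw [← Real.rpow_add hρ]; congr 1; ring
  rw [split_Ioi hρ]
  have e1 : ∫⁻ x in Set.Ioc 0 ρ, ENNReal.ofReal (KK α κ x ρ * x ^ (3 * α / 2))
      ≤ ENNReal.ofReal (ρ ^ (3 * α / 2) * Real.exp (-AA α κ ρ)) *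
        ENNReal.ofReal (Real.cosh (AA α κ ρ) - 1) := by
    rw [← int_sinh hα hκ hρ, ← lintegral_const_mul' _ _ ENNReal.ofReal_ne_top]
    refine setLIntegral_mono' measurableSet_Ioc fun x hx => ?_
    rw [← ENNReal.ofReal_mul (by positivity), hw x hx.1, HH_le _ _ _ _ hx.2]
    apply ENNReal.ofReal_le_ofReal
    have h1 : x ^ (2 * α) ≤ ρ ^ (2 * α) := Real.rpow_le_rpow hx.1.le hx.2 (by positivity)
    have h2 := Real.sinh_nonneg_iff.mpr (AA_nonneg hα hκ hx.1.le)
    have h3 := hx.1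
    rw [hr]
    calc _ ≤ ρ ^ (-(α / 2)) * (κ * x ^ α * (Real.exp (-AA α κ ρ) * Real.sinh (AA α κ x)))
          * ρ ^ (2 * α) := mul_le_mul_of_nonneg_left h1 (by positivity)
      _ = _ := by ring
  have e2 : ∫⁻ x in Set.Ioi ρ, ENNReal.ofReal (KK α κ x ρ * x ^ (3 * α / 2))
      ≤ ENNReal.ofReal (ρ ^ (3 * α / 2) * Real.sinh (AA α κ ρ) / AA α κ ρ) *
        ENNReal.ofReal ((AA α κ ρ + 1) * Real.exp (-AA α κ ρ)) := by
    rw [← int_mul_exp hα hκ hρ, ← lintegral_const_mul' _ _ ENNReal.ofReal_ne_top]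
    refine setLIntegral_mono' measurableSet_Ioi fun x hx => ?_
    have hx0 : 0 < x := hρ.trans hx
    rw [← ENNReal.ofReal_mul (by positivity), hw x hx0, HH_ge _ _ _ _ (le_of_lt hx)]
    apply ENNReal.ofReal_le_ofReal
    have h1 : x ^ (2 * α) ≤ ρ ^ (2 * α) * (AA α κ x / AA α κ ρ) := by
      have ha : AA α κ x / AA α κ ρ = (x / ρ) ^ (1 + α) := by
        unfold AA
        rw [Real.div_rpow hx0.le hρ.le]
        have : (1 + α) ≠ 0 := by positivity
        have : ρ ^ (1 + α) ≠ 0 := by positivity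
        field_simp
      have hb : x ^ (2 * α) = ρ ^ (2 * α) * (x / ρ) ^ (2 * α) := by
        rw [← Real.mul_rpow hρ.le (by positivity)]
        congr 1; field_simp
      rw [ha, hb]
      apply mul_le_mul_of_nonneg_left _ (by positivity)
      apply Real.rpow_le_rpow_of_exponent_le
      · rw [one_le_div hρ]; exact le_of_lt hx
      · linarith
    rw [hr]
    calc _ ≤ ρ ^ (-(α / 2)) * (κ * x ^ α * (Real.sinh (AA α κ ρ) * Real.exp (-AA α κ x)))
          * (ρ ^ (2 * α) * (AA α κ x / AA α κ ρ)) := mul_le_mul_of_nonneg_left h1 (by positivity)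
      _ = _ := by ring
  refine (add_le_add e1 e2).trans ?_
  rw [← ENNReal.ofReal_mul (by positivity), ← ENNReal.ofReal_mul (by positivity),
    ← ENNReal.ofReal_add (mul_nonneg (by positivity) (by linarith)) (by positivity)]
  apply ENNReal.ofReal_le_ofReal
  have h1 := sinh_mul_exp_le_half (AA α κ ρ)
  have h1' := sinh_mul_exp_le (AA α κ ρ)
  have h2 := cosh_mul_exp_le hT.le
  have h3 : 0 ≤ ρ ^ (3 * α / 2) := by positivity
  have h4 : Real.sinh (AA α κ ρ) * Real.exp (-AA α κ ρ) / AA α κ ρ ≤ 1 := by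
    rw [div_le_one hT]; exact h1'
  have h5 : Real.sinh (AA α κ ρ) * ((AA α κ ρ + 1) * Real.exp (-AA α κ ρ)) / AA α κ ρ
      = Real.sinh (AA α κ ρ) * Real.exp (-AA α κ ρ)
        + Real.sinh (AA α κ ρ) * Real.exp (-AA α κ ρ) / AA α κ ρ := by
    field_simp
  calc _ = ρ ^ (3 * α / 2) * (Real.exp (-AA α κ ρ) * (Real.cosh (AA α κ ρ) - 1)
        + Real.sinh (AA α κ ρ) * ((AA α κ ρ + 1) * Real.exp (-AA α κ ρ)) / AA α κ ρ) := by ring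
    _ ≤ ρ ^ (3 * α / 2) * 4 := mul_le_mul_of_nonneg_left (by linarith) h3
    _ = _ := mul_comm _ _

lemma KK_bdd {α κ x : ℝ} (hα : 0 < α) (hα1 : α < 1) (hκ : 0 < κ) (hx : 0 < x) :
    ∃ M : ℝ, 0 ≤ M ∧ ∀ ρ : ℝ, 0 < ρ → KK α κ x ρ * (ρ ^ (3 * α / 2))⁻¹ ≤ M := by
  refine ⟨κ * x ^ (3 * α / 2) * (κ * x ^ (1 - α)) + κ * x ^ (3 * α / 2) * x ^ (-(2 * α)),
    by positivity, fun ρ hρ => ?_⟩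
  have hw : KK α κ x ρ * (ρ ^ (3 * α / 2))⁻¹
      = κ * x ^ (3 * α / 2) * (ρ ^ (-(2 * α)) * HH α κ x ρ) := by
    have : ρ ^ (-(2 * α)) = ρ ^ (-(α / 2)) * (ρ ^ (3 * α / 2))⁻¹ := by
      rw [← Real.rpow_neg hρ.le, ← Real.rpow_add hρ]; congr 1; ring
    rw [this]; unfold KK; ring
  have hmono : ∀ a b : ℝ, 0 < a → a ≤ b → Real.exp (-AA α κ b) ≤ Real.exp (-AA α κ a) := by
    intro a b ha hab
    apply Real.exp_le_exp.mpr
    apply neg_le_neg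
    unfold AA
    have := Real.rpow_le_rpow ha.le hab (by positivity : 0 ≤ 1 + α)
    gcongr
  rw [hw, ← mul_add]
  apply mul_le_mul_of_nonneg_left _ (by positivity)
  rcases le_total ρ x with h | h
  · have h1 : HH α κ x ρ ≤ AA α κ ρ := by
      rw [HH_le _ _ _ _ h]
      refine le_trans ?_ (sinh_mul_exp_le _)
      rw [mul_comm]
      exact mul_le_mul_of_nonneg_left (hmono _ _ hρ h)
        (Real.sinh_nonneg_iff.mpr (AA_nonneg hα hκ hρ.le))
    have h2 : ρ ^ (-(2 * α)) * AA α κ ρ ≤ κ * x ^ (1 - α) := by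
      have : ρ ^ (-(2 * α)) * AA α κ ρ = κ * ρ ^ (1 - α) / (1 + α) := by
        have : ρ ^ (1 - α) = ρ ^ (-(2 * α)) * ρ ^ (1 + α) := by
          rw [← Real.rpow_add hρ]; congr 1; ring
        rw [this]; unfold AA; ring
      rw [this]
      have h3 := Real.rpow_le_rpow hρ.le h (by linarith : 0 ≤ 1 - α)
      calc _ ≤ κ * ρ ^ (1 - α) := div_le_self (by positivity) (by linarith)
        _ ≤ _ := by gcongr
    have h3 : 0 ≤ x ^ (-(2 * α)) := by positivity
    have h4 := mul_le_mul_of_nonneg_left h1 (by positivity : 0 ≤ ρ ^ (-(2 * α)))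
    linarith
  · have h1 : HH α κ x ρ ≤ 1 := by
      rw [HH_ge _ _ _ _ h]
      have := mul_le_mul_of_nonneg_left (hmono _ _ hx h)
        (Real.sinh_nonneg_iff.mpr (AA_nonneg hα hκ hx.le))
      have := sinh_mul_exp_le_half (AA α κ x)
      linarith
    have h2 : ρ ^ (-(2 * α)) ≤ x ^ (-(2 * α)) :=
      Real.rpow_le_rpow_of_nonpos hx h (by linarith)
    have h3 : 0 ≤ κ * x ^ (1 - α) := by positivity
    have h4 := mul_le_mul_of_nonneg_left h1 (by positivity : 0 ≤ ρ ^ (-(2 * α)))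
    linarith

lemma cs {μ : Measure ℝ} {f g : ℝ → ENNReal} (hf : AEMeasurable f μ) (hg : AEMeasurable g μ) :
    (∫⁻ a, f a * g a ∂μ) ^ 2 ≤ (∫⁻ a, f a ^ 2 ∂μ) * ∫⁻ a, g a ^ 2 ∂μ := by
  have h := ENNReal.lintegral_mul_le_Lp_mul_Lq μ Real.HolderConjugate.two_two hf hg
  simp only [Pi.mul_apply, ENNReal.rpow_ofNat] at h
  refine (pow_le_pow_left₀ zero_le h 2).trans ?_
  rw [mul_pow, ← ENNReal.rpow_natCast, ← ENNReal.rpow_natCast, ← ENNReal.rpow_mul,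
    ← ENNReal.rpow_mul]
  norm_num

lemma KK_meas (α κ : ℝ) : Measurable (Function.uncurry (KK α κ)) := by
  have hA : Measurable (AA α κ) := by unfold AA; fun_prop
  have hA1 : Measurable fun p : ℝ × ℝ => AA α κ p.1 := hA.comp measurable_fst
  have hA2 : Measurable fun p : ℝ × ℝ => AA α κ p.2 := hA.comp measurable_snd
  have hH : Measurable fun p : ℝ × ℝ => HH α κ p.1 p.2 := by
    unfold HH
    exact Measurable.ite (measurableSet_lt measurable_snd measurable_fst)
      ((Real.measurable_exp.comp hA1.neg).mul (Real.measurable_sinh.comp hA2))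
      ((Real.measurable_sinh.comp hA1).mul (Real.measurable_exp.comp hA2.neg))
  have : Function.uncurry (KK α κ) = fun p : ℝ × ℝ =>
      κ * p.1 ^ (3 * α / 2) * p.2 ^ (-(α / 2)) * HH α κ p.1 p.2 := by
    ext p; rfl
  rw [this]
  fun_prop

lemma pointwise_cs {α κ x : ℝ} (hα : 0 < α) (hκ : 0 < κ) (hx : 0 < x)
    {g : ℝ → ℝ} (hg : Measurable g) (hg0 : ∀ x, 0 ≤ g x) :
    (∫⁻ ρ in Set.Ioi 0, ENNReal.ofReal (KK α κ x ρ * g ρ)) ^ 2 ≤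
      ENNReal.ofReal (x ^ (3 * α / 2)) *
      ∫⁻ ρ in Set.Ioi 0, ENNReal.ofReal (KK α κ x ρ * (ρ ^ (3 * α / 2))⁻¹ * g ρ ^ 2) := by
  have hK : Measurable (KK α κ x) := (KK_meas α κ).comp measurable_prodMk_left
  have h := cs (μ := volume.restrict (Set.Ioi 0))
    (f := fun ρ => ENNReal.ofReal (Real.sqrt (KK α κ x ρ * ρ ^ (3 * α / 2))))
    (g := fun ρ => ENNReal.ofReal (Real.sqrt (KK α κ x ρ * (ρ ^ (3 * α / 2))⁻¹) * g ρ))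
    (by fun_prop) (by fun_prop)
  have e1 : ∫⁻ ρ in Set.Ioi 0, ENNReal.ofReal (Real.sqrt (KK α κ x ρ * ρ ^ (3 * α / 2))) *
      ENNReal.ofReal (Real.sqrt (KK α κ x ρ * (ρ ^ (3 * α / 2))⁻¹) * g ρ)
      = ∫⁻ ρ in Set.Ioi 0, ENNReal.ofReal (KK α κ x ρ * g ρ) := by
    refine setLIntegral_congr_fun measurableSet_Ioi fun ρ hρ => ?_
    have hρ0 : 0 < ρ := hρ
    have hk := KK_nonneg hα hκ hx hρ0
    rw [← ENNReal.ofReal_mul (by positivity), ← mul_assoc, ← Real.sqrt_mul (by positivity)]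
    congr 2
    rw [Real.sqrt_eq_iff_mul_self_eq (by positivity) hk]
    have : ρ ^ (3 * α / 2) ≠ 0 := by positivity
    field_simp
  have e2 : ∫⁻ ρ in Set.Ioi 0, ENNReal.ofReal (Real.sqrt (KK α κ x ρ * ρ ^ (3 * α / 2))) ^ 2
      = ∫⁻ ρ in Set.Ioi 0, ENNReal.ofReal (KK α κ x ρ * ρ ^ (3 * α / 2)) := by
    refine setLIntegral_congr_fun measurableSet_Ioi fun ρ hρ => ?_
    have hρ0 : 0 < ρ := hρ
    have hk := KK_nonneg hα hκ hx hρ0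
    rw [← ENNReal.ofReal_pow (by positivity), Real.sq_sqrt (by positivity)]
  have e3 : ∫⁻ ρ in Set.Ioi 0,
        ENNReal.ofReal (Real.sqrt (KK α κ x ρ * (ρ ^ (3 * α / 2))⁻¹) * g ρ) ^ 2
      = ∫⁻ ρ in Set.Ioi 0, ENNReal.ofReal (KK α κ x ρ * (ρ ^ (3 * α / 2))⁻¹ * g ρ ^ 2) := by
    refine setLIntegral_congr_fun measurableSet_Ioi fun ρ hρ => ?_
    have hρ0 : 0 < ρ := hρ
    have hk := KK_nonneg hα hκ hx hρ0
    have := hg0 ρ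
    rw [← ENNReal.ofReal_pow (by positivity), mul_pow, Real.sq_sqrt (by positivity)]
  rw [e1, e2, e3] at h
  exact h.trans (mul_le_mul_left (schur1 hα hκ hx) _)

lemma KK_integrable {α κ x : ℝ} (hα : 0 < α) (hα1 : α < 1) (hκ : 0 < κ) (hx : 0 < x)
    {g : ℝ → ℝ} (hg : Measurable g) (hg0 : ∀ x, 0 ≤ g x)
    (hi : IntegrableOn (fun x : ℝ => g x ^ 2) (Set.Ioi 0)) :
    IntegrableOn (fun ρ => KK α κ x ρ * g ρ) (Set.Ioi 0) := by
  have hK : Measurable (KK α κ x) := (KK_meas α κ).comp measurable_prodMk_left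
  obtain ⟨M, hM0, hM⟩ := KK_bdd hα hα1 hκ hx
  have hfin : ∫⁻ ρ in Set.Ioi 0, ENNReal.ofReal (KK α κ x ρ * (ρ ^ (3 * α / 2))⁻¹ * g ρ ^ 2)
      < ⊤ := by
    refine lt_of_le_of_lt (b := ∫⁻ ρ in Set.Ioi 0, ENNReal.ofReal (M * g ρ ^ 2)) ?_ ?_
    · refine setLIntegral_mono' measurableSet_Ioi fun ρ hρ => ?_
      exact ENNReal.ofReal_le_ofReal (mul_le_mul_of_nonneg_right (hM ρ hρ) (by positivity))
    · exact (hi.const_mul M).lintegral_lt_top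
  have h := (pointwise_cs hα hκ hx hg hg0).trans_lt (ENNReal.mul_lt_top ENNReal.ofReal_lt_top hfin)
  have h' : ∫⁻ ρ in Set.Ioi 0, ENNReal.ofReal (KK α κ x ρ * g ρ) < ⊤ := by
    by_contra hcon
    rw [not_lt, top_le_iff] at hcon
    rw [hcon] at h
    simp at h
  refine ⟨(hK.mul hg).aestronglyMeasurable, ?_⟩
  rw [hasFiniteIntegral_iff_ofReal]
  · exact h'
  · refine (ae_restrict_iff' measurableSet_Ioi).mpr (Filter.Eventually.of_forall fun ρ hρ => ?_)
    exact mul_nonneg (KK_nonneg hα hκ hx hρ) (hg0 ρ)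

lemma KK_bound {α κ : ℝ} (hα : 0 < α) (hα1 : α < 1) (hκ : 0 < κ)
    {g : ℝ → ℝ} (hg : Measurable g) (hg0 : ∀ x, 0 ≤ g x) :
    ∫⁻ x in Set.Ioi 0, (∫⁻ ρ in Set.Ioi 0, ENNReal.ofReal (KK α κ x ρ * g ρ)) ^ 2 ≤
      4 * ∫⁻ ρ in Set.Ioi 0, ENNReal.ofReal (g ρ ^ 2) := by
  have hK := KK_meas α κ
  have hK' : Measurable fun p : ℝ × ℝ => KK α κ p.1 p.2 := hK
  calc _ ≤ ∫⁻ x in Set.Ioi 0, ∫⁻ ρ in Set.Ioi 0, ENNReal.ofReal (x ^ (3 * α / 2)) *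
        ENNReal.ofReal (KK α κ x ρ * (ρ ^ (3 * α / 2))⁻¹ * g ρ ^ 2) := by
        refine setLIntegral_mono' measurableSet_Ioi fun x hx => ?_
        rw [lintegral_const_mul' _ _ ENNReal.ofReal_ne_top]
        exact pointwise_cs hα hκ hx hg hg0
    _ = ∫⁻ ρ in Set.Ioi 0, ∫⁻ x in Set.Ioi 0, ENNReal.ofReal (x ^ (3 * α / 2)) *
        ENNReal.ofReal (KK α κ x ρ * (ρ ^ (3 * α / 2))⁻¹ * g ρ ^ 2) := by
        apply lintegral_lintegral_swap
        apply Measurable.aemeasurable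
        unfold Function.uncurry
        fun_prop
    _ ≤ ∫⁻ ρ in Set.Ioi 0, 4 * ENNReal.ofReal (g ρ ^ 2) := by
        refine setLIntegral_mono' measurableSet_Ioi fun ρ hρ => ?_
        have hρ0 : 0 < ρ := hρ
        have e : ∫⁻ x in Set.Ioi 0, ENNReal.ofReal (x ^ (3 * α / 2)) *
            ENNReal.ofReal (KK α κ x ρ * (ρ ^ (3 * α / 2))⁻¹ * g ρ ^ 2)
            = ∫⁻ x in Set.Ioi 0, ENNReal.ofReal ((ρ ^ (3 * α / 2))⁻¹ * g ρ ^ 2) *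
              ENNReal.ofReal (KK α κ x ρ * x ^ (3 * α / 2)) := by
          refine setLIntegral_congr_fun measurableSet_Ioi fun x hx => ?_
          have hx0 : 0 < x := hx
          rw [← ENNReal.ofReal_mul (by positivity), ← ENNReal.ofReal_mul (by positivity)]
          congr 1; ring
        rw [e, lintegral_const_mul' _ _ ENNReal.ofReal_ne_top]
        refine (mul_le_mul_right (schur2 hα hα1 hκ hρ0) _).trans ?_
        rw [← ENNReal.ofReal_mul (by positivity)]
        have : (4 : ENNReal) = ENNReal.ofReal 4 := by simp
        rw [this, ← ENNReal.ofReal_mul (by positivity)]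
        apply le_of_eq
        congr 1
        have : ρ ^ (3 * α / 2) ≠ 0 := by positivity
        field_simp
    _ = _ := lintegral_const_mul' _ _ (by simp)

/-- For `α ∈ (0,1)` there is `C > 0`, depending only on `α`, such that for
every nonzero integer `k` and every nonnegative measurable square-integrable `g`, the inner
integral converges for every `x > 0` and
`∫₀^∞ ( x^{2α} k² ∫₀^∞ G_{α,k}(x,ρ) g(ρ) dρ )² dx ≤ C² ∫₀^∞ g²`: the operator with kernel
`x^{2α} k² G_{α,k}(x,ρ)` is bounded on `L²((0,∞))` uniformly in `k`. -/
theorem green_operator_uniformly_bounded (α : ℝ) (hα0 : 0 < α) (hα1 : α < 1) :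
    ∃ C : ℝ, 0 < C ∧ ∀ k : ℤ, k ≠ 0 → ∀ g : ℝ → ℝ, Measurable g → (∀ x, 0 ≤ g x) →
      IntegrableOn (fun x : ℝ => g x ^ 2) (Set.Ioi 0) →
      (∀ x : ℝ, 0 < x → IntegrableOn (fun ρ : ℝ => GreenG α k x ρ * g ρ) (Set.Ioi 0)) ∧
      ∫⁻ x in Set.Ioi (0 : ℝ),
          ENNReal.ofReal
            ((x ^ (2 * α) * (k : ℝ) ^ 2 * ∫ ρ in Set.Ioi (0 : ℝ), GreenG α k x ρ * g ρ) ^ 2) ≤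
        ENNReal.ofReal (C ^ 2 * ∫ x in Set.Ioi (0 : ℝ), g x ^ 2) := by
  refine ⟨2, by norm_num, fun k hk g hg hg0 hi => ?_⟩
  have hκ : 0 < |(k : ℝ)| := abs_pos.mpr (by exact_mod_cast hk)
  have hk2 : 0 < (k : ℝ) ^ 2 := by rw [← sq_abs]; positivity
  refine ⟨fun x hx => ?_, ?_⟩
  · have h := (KK_integrable hα0 hα1 hκ hx hg hg0 hi).const_mul (x ^ (2 * α) * (k : ℝ) ^ 2)⁻¹
    refine IntegrableOn.congr_fun h (fun ρ hρ => ?_) measurableSet_Ioi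
    have hne : x ^ (2 * α) * (k : ℝ) ^ 2 ≠ 0 := by positivity
    rw [← Green_eq hα0 hk hx hρ, mul_assoc (x ^ (2 * α) * (k : ℝ) ^ 2), inv_mul_cancel_left₀ hne]
  · have h := KK_bound hα0 hα1 hκ hg hg0
    rw [ENNReal.ofReal_mul (by norm_num), ofReal_integral_eq_lintegral_ofReal hi
      (Filter.Eventually.of_forall fun x => by positivity)]
    have h4 : ENNReal.ofReal (2 ^ 2) = 4 := by norm_num
    rw [h4]
    refine le_trans (le_of_eq ?_) h
    refine setLIntegral_congr_fun measurableSet_Ioi fun x hx => ?_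
    have hx0 : 0 < x := hx
    have hnn : ∀ ρ ∈ Set.Ioi (0 : ℝ), 0 ≤ KK α |(k : ℝ)| x ρ * g ρ := fun ρ hρ =>
      mul_nonneg (KK_nonneg hα0 hκ hx0 hρ) (hg0 ρ)
    have e : x ^ (2 * α) * (k : ℝ) ^ 2 * ∫ ρ in Set.Ioi (0 : ℝ), GreenG α k x ρ * g ρ
        = ∫ ρ in Set.Ioi (0 : ℝ), KK α |(k : ℝ)| x ρ * g ρ := by
      rw [← integral_const_mul]
      refine setIntegral_congr_fun measurableSet_Ioi fun ρ hρ => ?_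
      rw [← Green_eq hα0 hk hx0 hρ]; ring
    rw [e, ENNReal.ofReal_pow (setIntegral_nonneg measurableSet_Ioi hnn),
      ofReal_integral_eq_lintegral_ofReal (KK_integrable hα0 hα1 hκ hx0 hg hg0 hi)
      ((ae_restrict_iff' measurableSet_Ioi).mpr (Filter.Eventually.of_forall hnn))]
end

section
/- Let α ∈ (0,1) and let k be a nonzero integer. For every measurable square-integrable g : (0,∞) → ℂ, the function x ↦ ∫₀^∞ G_{α,k}(x,ρ)·g(ρ) dρ belongs to the weighted space L²((0,∞), ⟨x⟩^{4α} dx); that is, ∫₀^∞ (1+x²)^{2α} · | ∫₀^∞ G_{α,k}(x,ρ)·g(ρ) dρ |² dx < ∞. -/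
open MeasureTheory

lemma lemB0 (α δ : ℝ) (hα0 : 0 < α) (hα1 : α < 1) (hδ : 0 < δ) (s m : ℝ) (hs : 0 < s) (hsm : s ≤ m) :
    (1 + m) ^ α * Real.exp (-(δ * (m - s))) ≤
      (1 + 1 / δ) * (1 + s) ^ α := by
  have hd : 0 ≤ m - s := by linarith
  have h1 : (1 + m) ^ α ≤ (1 + s) ^ α * (1 + (m - s)) := by
    calc (1 + m) ^ α ≤ ((1 + s) * (1 + (m - s))) ^ α := by
          apply Real.rpow_le_rpow (by linarith) _ hα0.le
          nlinarith
      _ = (1 + s) ^ α * (1 + (m - s)) ^ α := Real.mul_rpow (by linarith) (by linarith)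
      _ ≤ _ := by
          gcongr
          exact Real.rpow_le_self_of_one_le (by linarith) hα1.le
  have h2 : 1 + (m - s) ≤ (1 + 1 / δ) * Real.exp (δ * (m - s)) := by
    have := Real.add_one_le_exp (δ * (m - s))
    have h3 : (1 + 1 / δ) * (δ * (m - s) + 1) = 1 + (m-s) + δ * (m - s) + 1 / δ := by
      field_simp; ring
    have h4 : (1 + 1 / δ) * (δ * (m - s) + 1) ≤ (1 + 1 / δ) * Real.exp (δ * (m - s)) := by gcongr
    have : 0 < 1 / δ := by positivity
    nlinarith [mul_nonneg hδ.le hd]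
  have h5 : (1 + m) ^ α ≤ (1 + s) ^ α * ((1 + 1 / δ) * Real.exp (δ * (m - s))) :=
    h1.trans (by gcongr)
  rw [Real.exp_neg, ← div_eq_mul_inv, div_le_iff₀ (Real.exp_pos _)]
  linarith

lemma lemB (α δ : ℝ) (hα0 : 0 < α) (hα1 : α < 1) (hδ : 0 < δ) (s m : ℝ) (hs : 0 < s) (hsm : s ≤ m) :
    (1 + m) ^ α * Real.exp (-(2 * δ * (1 + m) ^ α * (m - s))) ≤
      (1 + 1 / δ) * ((1 + s) ^ α * Real.exp (-(δ * (1 + s) ^ α * (m - s)))) := by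
  have hd : 0 ≤ m - s := by linarith
  have h1 := lemB0 α δ hα0 hα1 hδ s m hs hsm
  have h2 : (1:ℝ) ≤ (1 + m) ^ α := Real.one_le_rpow (by linarith) hα0.le
  have h3 : (1 + s) ^ α ≤ (1 + m) ^ α := Real.rpow_le_rpow (by linarith) (by linarith) hα0.le
  have h4 : Real.exp (-(2 * δ * (1 + m) ^ α * (m - s))) ≤
      Real.exp (-(δ * (m - s))) * Real.exp (-(δ * (1 + s) ^ α * (m - s))) := by
    rw [← Real.exp_add]
    apply Real.exp_le_exp.2
    have a1 : δ * (m - s) * 1 ≤ δ * (m - s) * (1 + m) ^ α := by gcongr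
    have a2 : δ * (m - s) * (1 + s) ^ α ≤ δ * (m - s) * (1 + m) ^ α := by gcongr
    nlinarith
  calc _ ≤ (1 + m) ^ α * (Real.exp (-(δ * (m - s))) * Real.exp (-(δ * (1 + s) ^ α * (m - s)))) := by gcongr
    _ = ((1 + m) ^ α * Real.exp (-(δ * (m - s)))) * Real.exp (-(δ * (1 + s) ^ α * (m - s))) := by ring
    _ ≤ ((1 + 1 / δ) * (1 + s) ^ α) * Real.exp (-(δ * (1 + s) ^ α * (m - s))) := by gcongr
    _ = _ := by ring

/-- diagonal factor -/
lemma lemS (α c : ℝ) (hα0 : 0 < α) (hα1 : α < 1) (hc : 0 < c) (s : ℝ) (hs : 0 < s) :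
    s ^ (-α) * (Real.exp (-(c * s ^ (1 + α))) * Real.sinh (c * s ^ (1 + α))) ≤
      2 * (c + 1) * (1 + s) ^ (-α) := by
  have hsα : 0 < s ^ α := Real.rpow_pos_of_pos hs _
  have hs1 : s ^ (1 + α) = s * s ^ α := by rw [Real.rpow_add hs, Real.rpow_one]
  set t := c * s ^ (1 + α) with ht
  have htpos : 0 ≤ t := by positivity
  have hE : Real.exp (-t) * Real.sinh t = (1 - Real.exp (-(2 * t))) / 2 := by
    rw [Real.sinh_eq, show -(2 * t) = -t + -t by ring, Real.exp_add]
    have : Real.exp (-t) * Real.exp t = 1 := by rw [← Real.exp_add]; simp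
    linear_combination this / 2
  have h1 : Real.exp (-t) * Real.sinh t ≤ 1 := by
    rw [hE]; linarith [Real.exp_pos (-(2 * t))]
  have h2 : Real.exp (-t) * Real.sinh t ≤ t := by
    rw [hE]; linarith [Real.add_one_le_exp (-(2 * t))]
  have h0 : 0 ≤ Real.exp (-t) * Real.sinh t :=
    mul_nonneg (Real.exp_pos _).le (Real.sinh_nonneg_iff.2 htpos)
  rw [Real.rpow_neg hs.le, Real.rpow_neg (by linarith), ← div_eq_mul_inv, ← div_eq_inv_mul,
    div_le_div_iff₀ hsα (by positivity)]
  have hp : 0 < (1 + s) ^ α := by positivity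
  rcases le_total 1 s with h | h
  · have : (1 + s) ^ α ≤ 2 * s ^ α := by
      calc (1 + s) ^ α ≤ (2 * s) ^ α := Real.rpow_le_rpow (by linarith) (by linarith) hα0.le
        _ = 2 ^ α * s ^ α := Real.mul_rpow (by norm_num) hs.le
        _ ≤ _ := by gcongr; exact Real.rpow_le_self_of_one_le (by norm_num) hα1.le
    calc _ ≤ 1 * (2 * s ^ α) := by gcongr
      _ ≤ _ := by nlinarith
  · have : (1 + s) ^ α ≤ 2 :=
      (Real.rpow_le_self_of_one_le (by linarith) hα1.le).trans (by linarith)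
    calc _ ≤ t * 2 := by gcongr
      _ = 2 * c * s ^ α * s := by rw [ht, hs1]; ring
      _ ≤ 2 * c * s ^ α * 1 := by gcongr
      _ ≤ _ := by nlinarith

lemma lemD (α c : ℝ) (hα0 : 0 < α) (hα1 : α < 1) (hc : 0 < c) (s m : ℝ) (hs : 0 < s) (hsm : s ≤ m) :
    (c / 2) * (1 + m) ^ α * (m - s) - c ≤ c * m ^ (1 + α) - c * s ^ (1 + α) := by
  have hm : 0 < m := by linarith
  have hd : 0 ≤ m - s := by linarith
  have hs1 : s ^ (1 + α) = s * s ^ α := by rw [Real.rpow_add hs, Real.rpow_one]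
  have hm1 : m ^ (1 + α) = m * m ^ α := by rw [Real.rpow_add hm, Real.rpow_one]
  have h3 : s ^ α ≤ m ^ α := Real.rpow_le_rpow hs.le hsm hα0.le
  have h4 : c * (m ^ α * (m - s)) ≤ c * m ^ (1 + α) - c * s ^ (1 + α) := by
    rw [hs1, hm1, ← mul_sub]; gcongr; nlinarith
  refine le_trans ?_ h4
  have hmα : 0 < m ^ α := by positivity
  rcases le_total 1 m with h | h
  · have : (1 + m) ^ α ≤ 2 * m ^ α := by
      calc (1 + m) ^ α ≤ (2 * m) ^ α := Real.rpow_le_rpow (by linarith) (by linarith) hα0.le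
        _ = 2 ^ α * m ^ α := Real.mul_rpow (by norm_num) hm.le
        _ ≤ _ := by gcongr; exact Real.rpow_le_self_of_one_le (by norm_num) hα1.le
    have : (c / 2) * (1 + m) ^ α * (m - s) ≤ (c / 2) * (2 * m ^ α) * (m - s) := by gcongr
    nlinarith
  · have : (1 + m) ^ α ≤ 2 :=
      (Real.rpow_le_self_of_one_le (by linarith) hα1.le).trans (by linarith)
    have : (c / 2) * (1 + m) ^ α * (m - s) ≤ (c / 2) * 2 * 1 := by
      gcongr
      linarith
    have : 0 ≤ c * (m ^ α * (m - s)) := by positivity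
    nlinarith

lemma lemA (α c : ℝ) (hα0 : 0 < α) (hα1 : α < 1) (hc : 0 < c) :
    ∃ C δ : ℝ, 0 < C ∧ 0 < δ ∧ ∀ s m : ℝ, 0 < s → s ≤ m →
    (1 + m) ^ (2 * α) * (m ^ (-(α / 2)) * s ^ (-(α / 2)) *
      (Real.exp (-(c * m ^ (1 + α))) * Real.sinh (c * s ^ (1 + α)))) ≤
      C * ((1 + m) ^ α * Real.exp (-(δ * (1 + m) ^ α * (m - s)))) := by
  refine ⟨2 * (c + 1) * Real.exp c * (1 + 1 / (c / 4)), c / 4, by positivity, by positivity, ?_⟩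
  intro s m hs hsm
  have hm : 0 < m := by linarith
  have hd : 0 ≤ m - s := by linarith
  have hS := lemS α c hα0 hα1 hc s hs
  have hD := lemD α c hα0 hα1 hc s m hs hsm
  have hB := lemB0 α (c / 4) hα0 hα1 (by positivity) s m hs hsm
  have hsinh : 0 ≤ Real.sinh (c * s ^ (1 + α)) := Real.sinh_nonneg_iff.2 (by positivity)
  have e1 : m ^ (-(α / 2)) * s ^ (-(α / 2)) ≤ s ^ (-α) := by
    rw [show -α = -(α/2) + -(α/2) by ring, Real.rpow_add hs]
    gcongr ?_ * _
    exact Real.rpow_le_rpow_of_nonpos hs hsm (by linarith)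
  have e2 : Real.exp (-(c * m ^ (1 + α))) ≤ Real.exp (-(c * s ^ (1 + α))) *
      (Real.exp c * Real.exp (-(c / 4 * (m - s))) * Real.exp (-(c / 4 * (1 + m) ^ α * (m - s)))) := by
    rw [← Real.exp_add, ← Real.exp_add, ← Real.exp_add]
    apply Real.exp_le_exp.2
    have h2 : (1:ℝ) ≤ (1 + m) ^ α := Real.one_le_rpow (by linarith) hα0.le
    have a1 : c / 4 * (m - s) * 1 ≤ c / 4 * (m - s) * (1 + m) ^ α := by gcongr
    nlinarith
  have e3 : (1 + m) ^ (2 * α) = (1 + m) ^ α * (1 + m) ^ α := by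
    rw [two_mul, Real.rpow_add (by linarith)]
  have e4 : (1 + s) ^ (-α) * (1 + s) ^ α = 1 := by
    rw [← Real.rpow_add (by linarith)]; simp
  set E := Real.exp (-(c / 4 * (1 + m) ^ α * (m - s)))
  set E' := Real.exp (-(c / 4 * (m - s)))
  set S := Real.sinh (c * s ^ (1 + α))
  calc _ ≤ (1 + m) ^ (2 * α) * (s ^ (-α) * (Real.exp (-(c * s ^ (1 + α))) *
      (Real.exp c * E' * E) * S)) := by gcongr
    _ = (1 + m) ^ α * (Real.exp c * E) * ((1 + m) ^ α * E') * (s ^ (-α) * (Real.exp (-(c * s ^ (1 + α))) * S)) := by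
        rw [e3]; ring
    _ ≤ (1 + m) ^ α * (Real.exp c * E) * ((1 + 1 / (c / 4)) * (1 + s) ^ α) * (2 * (c + 1) * (1 + s) ^ (-α)) := by
        gcongr
    _ = _ := by linear_combination ((1 + m) ^ α * (Real.exp c * E) * (1 + 1 / (c / 4)) * (2 * (c + 1))) * e4

lemma schur (μ : Measure ℝ) [SFinite μ] (h : ℝ → ℝ → ENNReal) (hh : Measurable (Function.uncurry h))
    (f : ℝ → ENNReal) (hf : Measurable f) (A : ENNReal)
    (h1 : ∀ᵐ x ∂μ, ∫⁻ y, h x y ∂μ ≤ A) (h2 : ∀ᵐ y ∂μ, ∫⁻ x, h x y ∂μ ≤ A) :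
    ∫⁻ x, (∫⁻ y, h x y * f y ∂μ) ^ 2 ∂μ ≤ A * (A * ∫⁻ y, f y ^ 2 ∂μ) := by
  have hx : ∀ x, Measurable (h x) := fun x => hh.comp measurable_prodMk_left
  have cs : ∀ x, (∫⁻ y, h x y * f y ∂μ) ^ 2 ≤ (∫⁻ y, h x y ∂μ) * ∫⁻ y, h x y * f y ^ 2 ∂μ := by
    intro x
    have := ENNReal.lintegral_mul_le_Lp_mul_Lq μ (p := 2) (q := 2) (Real.HolderConjugate.two_two)
      (f := fun y => h x y ^ (1/2:ℝ)) (g := fun y => h x y ^ (1/2:ℝ) * f y)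
      ((hx x).pow_const _).aemeasurable (((hx x).pow_const _).mul hf).aemeasurable
    have half : ∀ a : ENNReal, (a ^ (1/2:ℝ)) ^ (2:ℕ) = a := by
      intro a; rw [← ENNReal.rpow_natCast, ← ENNReal.rpow_mul]; norm_num
    have half' : ∀ a : ENNReal, a ^ (1/2:ℝ) * a ^ (1/2:ℝ) = a := by
      intro a; rw [← sq, half]
    simp only [Pi.mul_apply, ← mul_assoc, half', ENNReal.rpow_two, mul_pow, half] at this
    calc _ ≤ _ := pow_le_pow_left' this 2
      _ = _ := by rw [mul_pow, half, half]
  calc ∫⁻ x, (∫⁻ y, h x y * f y ∂μ) ^ 2 ∂μ ≤ ∫⁻ x, A * ∫⁻ y, h x y * f y ^ 2 ∂μ ∂μ := by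
        apply lintegral_mono_ae
        filter_upwards [h1] with x hx1
        exact (cs x).trans (by gcongr)
    _ = A * ∫⁻ x, ∫⁻ y, h x y * f y ^ 2 ∂μ ∂μ := by
        rw [lintegral_const_mul]
        apply Measurable.lintegral_prod_right
        exact hh.mul ((hf.comp measurable_snd).pow_const 2)
    _ = A * ∫⁻ y, ∫⁻ x, h x y * f y ^ 2 ∂μ ∂μ := by
        rw [lintegral_lintegral_swap]
        exact (hh.mul ((hf.comp measurable_snd).pow_const 2)).aemeasurable
    _ ≤ A * ∫⁻ y, A * f y ^ 2 ∂μ := by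
        gcongr A * ?_
        apply lintegral_mono_ae
        filter_upwards [h2] with y hy
        rw [lintegral_mul_const]
        · gcongr
        · exact hh.comp measurable_prodMk_right
    _ = _ := by rw [lintegral_const_mul _ (hf.pow_const 2)]

lemma expint (b C a : ℝ) (hb : 0 < b) (hC : 0 ≤ C) :
    ∫⁻ y in Set.Ioi (0:ℝ), ENNReal.ofReal (C * (b * Real.exp (-(b * |a - y|)))) ≤ ENNReal.ofReal (2 * C) := by
  calc _ ≤ ∫⁻ y, ENNReal.ofReal (C * (b * Real.exp (-(b * |a - y|)))) := setLIntegral_le_lintegral _ _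
    _ = ∫⁻ y, ENNReal.ofReal (C * (b * Real.exp (-(b * |y|)))) :=
        lintegral_sub_left_eq_self (fun y => ENNReal.ofReal (C * (b * Real.exp (-(b * |y|))))) a
    _ = ENNReal.ofReal (∫ y, C * (b * Real.exp (-(b * |y|)))) := by
        rw [ofReal_integral_eq_lintegral_ofReal]
        · apply Integrable.const_mul
          apply Integrable.const_mul
          apply not_imp_comm.1 integral_undef
          rw [integral_comp_abs (f := fun y => Real.exp (-(b * y)))]
          have := integral_exp_mul_Ioi (a := -b) (by linarith) 0
          simp only [neg_mul] at this
          rw [this]; simp; exact hb.ne'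
        · filter_upwards with y; positivity
    _ ≤ _ := by
        apply ENNReal.ofReal_le_ofReal
        rw [integral_const_mul, integral_const_mul, integral_comp_abs (f := fun y => Real.exp (-(b * y)))]
        have := integral_exp_mul_Ioi (a := -b) (by linarith) 0
        simp only [neg_mul] at this
        rw [this]; simp; field_simp; rfl

/-- The kernel factor. -/
lemma kernel_bound (α : ℝ) (hα0 : 0 < α) (hα1 : α < 1) (k : ℤ) (hk : k ≠ 0) :
    ∃ C δ : ℝ, 0 < C ∧ 0 < δ ∧ ∀ x ρ : ℝ, 0 < x → 0 < ρ →
      (1 + x ^ 2) ^ α * |GreenG α k x ρ| ≤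
        C * ((1 + x) ^ α * Real.exp (-(δ * (1 + x) ^ α * |x - ρ|))) ∧
      (1 + x ^ 2) ^ α * |GreenG α k x ρ| ≤
        C * ((1 + ρ) ^ α * Real.exp (-(δ * (1 + ρ) ^ α * |x - ρ|))) := by
  have hk' : 0 < |(k : ℝ)| := abs_pos.2 (by exact_mod_cast hk)
  set c := |(k : ℝ)| / (1 + α) with hc
  have hcpos : 0 < c := by positivity
  obtain ⟨C, δ, hC, hδ, hA⟩ := lemA α c hα0 hα1 hcpos
  set N := (1 + α)⁻¹ * Real.sqrt (Real.pi * (1 + α) / (2 * |(k : ℝ)|)) *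
    Real.sqrt (2 * (1 + α) / (Real.pi * |(k : ℝ)|)) with hN
  have hN0 : 0 ≤ N := by positivity
  set Q : ℝ → ℝ → ℝ := fun s m => m ^ (-(α / 2)) * s ^ (-(α / 2)) *
      (Real.exp (-(c * m ^ (1 + α))) * Real.sinh (c * s ^ (1 + α))) with hQ
  have hQ0 : ∀ s m, 0 < s → 0 < m → 0 ≤ Q s m := by
    intro s m hs hm
    have : 0 ≤ Real.sinh (c * s ^ (1 + α)) := Real.sinh_nonneg_iff.2 (by positivity)
    simp only [hQ]; positivity
  have hG1 : ∀ x ρ, ρ < x → GreenG α k x ρ = N * Q ρ x := by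
    intro x ρ h
    simp only [GreenG, if_pos h, PhiG, FG, hQ, hN, hc, div_mul_eq_mul_div]; ring
  have hG2 : ∀ x ρ, x ≤ ρ → GreenG α k x ρ = N * Q x ρ := by
    intro x ρ h
    simp only [GreenG, if_neg (not_lt.2 h), PhiG, FG, hQ, hN, hc, div_mul_eq_mul_div]; ring
  have hw : ∀ x m : ℝ, 0 < x → x ≤ m → (1 + x ^ 2) ^ α ≤ (1 + m) ^ (2 * α) := by
    intro x m hx hm
    rw [Real.rpow_mul (by linarith)]
    apply Real.rpow_le_rpow (by positivity) _ hα0.le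
    rw [Real.rpow_two]; nlinarith
  set K := (N + 1) * C * (1 + 1 / (δ / 2)) with hK
  have key : ∀ x s m : ℝ, 0 < x → x ≤ m → 0 < s → s ≤ m →
      (1 + x ^ 2) ^ α * |N * Q s m| ≤ K * ((1 + m) ^ α * Real.exp (-(δ / 2 * (1 + m) ^ α * (m - s)))) ∧
      (1 + x ^ 2) ^ α * |N * Q s m| ≤ K * ((1 + s) ^ α * Real.exp (-(δ / 2 * (1 + s) ^ α * (m - s)))) := by
    intro x s m hx hxm hs hsm
    have hm : 0 < m := by linarith
    have hd : 0 ≤ m - s := by linarith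
    have hq := hQ0 s m hs hm
    have b0 : (1 + x ^ 2) ^ α * |N * Q s m| ≤
        (N + 1) * (C * ((1 + m) ^ α * Real.exp (-(δ * (1 + m) ^ α * (m - s))))) := by
      rw [abs_of_nonneg (by positivity)]
      calc _ ≤ (1 + m) ^ (2 * α) * ((N + 1) * Q s m) := by
            gcongr
            · exact hw x m hx hxm
            · linarith
        _ = (N + 1) * ((1 + m) ^ (2 * α) * Q s m) := by ring
        _ ≤ _ := mul_le_mul_of_nonneg_left (hA s m hs hsm) (by linarith)
    have hB := lemB α (δ / 2) hα0 hα1 (by positivity) s m hs hsm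
    rw [show 2 * (δ / 2) = δ by ring] at hB
    constructor
    · refine b0.trans ?_
      have e : Real.exp (-(δ * (1 + m) ^ α * (m - s))) ≤ Real.exp (-(δ / 2 * (1 + m) ^ α * (m - s))) := by
        apply Real.exp_le_exp.2
        have : 0 ≤ δ * (1 + m) ^ α * (m - s) := by positivity
        nlinarith
      have h1 : 1 ≤ 1 + 1 / (δ / 2) := by
        have : 0 < 1 / (δ / 2) := by positivity
        linarith
      calc _ ≤ (N + 1) * (C * ((1 + m) ^ α * Real.exp (-(δ / 2 * (1 + m) ^ α * (m - s))))) := by gcongr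
        _ = (N + 1) * C * 1 * ((1 + m) ^ α * Real.exp (-(δ / 2 * (1 + m) ^ α * (m - s)))) := by ring
        _ ≤ _ := by rw [hK]; gcongr
    · refine b0.trans ?_
      calc _ ≤ (N + 1) * (C * ((1 + 1 / (δ / 2)) * ((1 + s) ^ α * Real.exp (-(δ / 2 * (1 + s) ^ α * (m - s)))))) := by gcongr
        _ = _ := by rw [hK]; ring
  refine ⟨K, δ / 2, by positivity, by positivity, ?_⟩
  intro x ρ hx hρ
  rcases lt_or_ge ρ x with h | h
  · rw [hG1 x ρ h, abs_of_pos (show 0 < x - ρ by linarith)]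
    exact key x ρ x hx le_rfl hρ h.le
  · rw [hG2 x ρ h, abs_sub_comm x ρ, abs_of_nonneg (show 0 ≤ ρ - x by linarith)]
    exact (key x x ρ hx h hx h).symm

lemma measurable_GreenG (α : ℝ) (k : ℤ) : Measurable (fun p : ℝ × ℝ => GreenG α k p.1 p.2) := by
  have h1 : Measurable (PhiG α k) := by unfold PhiG; fun_prop
  have h2 : Measurable (FG α k) := by unfold FG; fun_prop
  unfold GreenG
  apply Measurable.ite (measurableSet_lt measurable_snd measurable_fst)
  · fun_prop
  · fun_prop

/-- For `α ∈ (0,1)`, nonzero `k`, and every measurable square-integrable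
`g : (0,∞) → ℂ`, the function `x ↦ ∫₀^∞ G_{α,k}(x,ρ) g(ρ) dρ` belongs to the weighted space
`L²((0,∞), ⟨x⟩^{4α} dx)`: `∫₀^∞ (1+x²)^{2α} ‖∫₀^∞ G_{α,k}(x,ρ) g(ρ) dρ‖² dx < ∞`. -/
theorem green_operator_range_in_weighted_L2 (α : ℝ) (hα0 : 0 < α) (hα1 : α < 1)
    (k : ℤ) (hk : k ≠ 0) (g : ℝ → ℂ) (hm : Measurable g)
    (hL2 : IntegrableOn (fun x : ℝ => ‖g x‖ ^ 2) (Set.Ioi 0)) :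
    IntegrableOn
      (fun x : ℝ =>
        (1 + x ^ 2) ^ (2 * α) *
          ‖∫ ρ in Set.Ioi (0 : ℝ), (GreenG α k x ρ : ℂ) * g ρ‖ ^ 2)
      (Set.Ioi 0) := by
  obtain ⟨C, δ, hC, hδ, hb⟩ := kernel_bound α hα0 hα1 k hk
  have hGm := measurable_GreenG α k
  have hGgm : Measurable (fun p : ℝ × ℝ => (GreenG α k p.1 p.2 : ℂ) * g p.2) :=
    (Complex.measurable_ofReal.comp hGm).mul (hm.comp measurable_snd)
  have hTm : StronglyMeasurable
      (fun x : ℝ => ∫ ρ in Set.Ioi (0 : ℝ), (GreenG α k x ρ : ℂ) * g ρ) :=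
    StronglyMeasurable.integral_prod_right' (f := fun p : ℝ × ℝ => (GreenG α k p.1 p.2 : ℂ) * g p.2)
      hGgm.stronglyMeasurable
  have hwm : Measurable (fun x : ℝ => (1 + x ^ 2) ^ (2 * α)) := by fun_prop
  refine ⟨(hwm.mul (hTm.measurable.norm.pow_const 2)).aestronglyMeasurable, ?_⟩
  set h : ℝ → ℝ → ENNReal := fun x ρ =>
    ENNReal.ofReal ((1 + x ^ 2) ^ α * |GreenG α k x ρ|) with hh
  have hhm : Measurable (Function.uncurry h) := by
    apply Measurable.ennreal_ofReal
    apply Measurable.mul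
    · fun_prop
    · exact hGm.norm
  set A : ENNReal := ENNReal.ofReal (2 * (C / δ)) with hA
  have hS := schur (volume.restrict (Set.Ioi (0:ℝ))) h hhm (fun y => ‖g y‖ₑ) hm.enorm A ?_ ?_
  · unfold HasFiniteIntegral
    refine lt_of_le_of_lt ((lintegral_mono fun x => ?_).trans hS) ?_
    · have hp : 0 ≤ (1 + x ^ 2) ^ α := by positivity
      have e1 : (1 + x ^ 2) ^ (2 * α) = ((1 + x ^ 2) ^ α) ^ 2 := by
        rw [mul_comm, Real.rpow_mul (by positivity), Real.rpow_two]
      beta_reduce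
      rw [e1, ← mul_pow, enorm_pow]
      gcongr ?_ ^ 2
      rw [enorm_mul, enorm_norm]
      refine (mul_le_mul_right (enorm_integral_le_lintegral_enorm _) _).trans ?_
      rw [← lintegral_const_mul]
      · apply le_of_eq
        congr 1
        funext ρ
        rw [enorm_mul, ← mul_assoc, hh]
        simp only
        rw [ENNReal.ofReal_mul hp, Real.enorm_of_nonneg hp, ← ofReal_norm (GreenG α k x ρ : ℂ),
          Complex.norm_real, Real.norm_eq_abs]
      · exact (hGgm.comp (measurable_prodMk_left (x := x))).enorm
    · apply ENNReal.mul_lt_top ENNReal.ofReal_lt_top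
      apply ENNReal.mul_lt_top ENNReal.ofReal_lt_top
      have := hL2.2
      unfold HasFiniteIntegral at this
      simpa [enorm_pow] using this
  · filter_upwards [ae_restrict_mem measurableSet_Ioi] with x hx
    have hx' : 0 < x := hx
    refine le_trans ?_ (expint (δ * (1 + x) ^ α) (C / δ) x (by positivity) (by positivity))
    apply setLIntegral_mono' measurableSet_Ioi
    intro ρ hρ
    apply ENNReal.ofReal_le_ofReal
    refine (hb x ρ hx hρ).1.trans (le_of_eq ?_)
    field_simp
  · filter_upwards [ae_restrict_mem measurableSet_Ioi] with ρ hρ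
    have hρ' : 0 < ρ := hρ
    refine le_trans ?_ (expint (δ * (1 + ρ) ^ α) (C / δ) ρ (by positivity) (by positivity))
    apply setLIntegral_mono' measurableSet_Ioi
    intro x hx
    apply ENNReal.ofReal_le_ofReal
    refine (hb x ρ hx hρ).2.trans (le_of_eq ?_)
    rw [abs_sub_comm x ρ]
    field_simp
end
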